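/- Let d > 3 and let T = T_{L,π} be an interval exchange transformation on d intervals with irreducible non-degenerate permutation π, admitting n steps of Rauzy induction, and let M = M(T,n). Then there exist a permutation σ in the Rauzy class of π that is a (4321) proxy (σ(d−3)=d, σ(d−2)=d−1, σ(d−1)=d−2, σ(d)=1) or a (4321) quasi-proxy (σ(1)=d, σ(d−2)=d−1, σ(d−1)=d−2, σ(d)=1), r > 0, and a nonempty open set U ⊆ M_Δ such that every IET S on d intervals with π(S) = π and length vector in U admits n + r steps of Rauzy induction, satisfies π(R^{n+r}(S)) = σ, and the matrix N = M(S, n+r) satisfies gcd(|C_m(N)|, |C_{d−2}(N)|, |C_{d−1}(N)|, |C_d(N)|) = 1, where m = d−3 if σ is a (4321) proxy and m = 1 if σ is a (4321) quasi-proxy. -/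

import Mathlib

open Finset MeasureTheory

namespace IETPaper

/-- The first index `0` of `Fin d` (corresponding to `1` in `{1,…,d}`). -/
def firstIdx (d : ℕ) [NeZero d] : Fin d := ⟨0, Nat.pos_of_ne_zero (NeZero.ne d)⟩

/-- The last index `d-1` of `Fin d` (corresponding to `d` in `{1,…,d}`). -/
def lastIdx (d : ℕ) [NeZero d] : Fin d :=
  ⟨d - 1, Nat.sub_lt (Nat.pos_of_ne_zero (NeZero.ne d)) one_pos⟩

/-- Left endpoint `l₁ + ⋯ + l_{j-1}` of the `j`-th interval `I_j`. -/
noncomputable def leftEnd {d : ℕ} (L : Fin d → ℝ) (j : Fin d) : ℝ :=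
  ∑ k ∈ Finset.univ.filter (fun k => k < j), L k

/-- The interval exchange transformation `T_{L,π}`: on the interval
`I_j = [leftEnd L j, leftEnd L j + L j)` it is the translation
`x ↦ x - ∑_{k < j} l_k + ∑_{π k' < π j} l_{k'}`; elsewhere it is the identity. -/
noncomputable def ietMap {d : ℕ} (π : Equiv.Perm (Fin d)) (L : Fin d → ℝ) (x : ℝ) : ℝ :=
  if h : ∃ j : Fin d, x ∈ Set.Ico (leftEnd L j) (leftEnd L j + L j) then
    x - leftEnd L h.choose + ∑ k ∈ Finset.univ.filter (fun k => π k < π h.choose), L k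
  else x

/-- Topological mixing of `T` on the subspace `X ⊆ ℝ` (with its subspace topology:
open sets of `X` are exactly the sets `U ∩ X` with `U` open in `ℝ`). -/
def TopMixingOn (T : ℝ → ℝ) (X : Set ℝ) : Prop :=
  ∀ U V : Set ℝ, IsOpen U → IsOpen V → (U ∩ X).Nonempty → (V ∩ X).Nonempty →
    ∃ N : ℕ, ∀ n : ℕ, N ≤ n → ((T^[n] '' (U ∩ X)) ∩ (V ∩ X)).Nonempty

/-- Irreducibility of a permutation: `π {1,…,k} ≠ {1,…,k}` for all `k < d`
(0-indexed: `π` does not preserve `{j | j < k}` for `0 < k < d`). -/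
def IsIrreducible {d : ℕ} (π : Equiv.Perm (Fin d)) : Prop :=
  ∀ k : ℕ, 0 < k → k < d →
    (⇑π '' {j : Fin d | (j : ℕ) < k}) ≠ {j : Fin d | (j : ℕ) < k}

/-- A permutation of `{1,…,d}` (written 0-indexed on `Fin d`) is degenerate if for some
`1 ≤ j < d` (0-indexed: `j + 1 < d`) one of the four listed conditions holds. -/
def IsDegenerate {d : ℕ} (π : Equiv.Perm (Fin d)) : Prop :=
  ∃ j : ℕ, ∃ hj : j + 1 < d,
    ((π ⟨j + 1, hj⟩ : ℕ) = (π ⟨j, by omega⟩ : ℕ) + 1) ∨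
    ((π ⟨j, by omega⟩ : ℕ) = d - 1 ∧ (π ⟨j + 1, hj⟩ : ℕ) = 0 ∧
      (π ⟨0, by omega⟩ : ℕ) = (π ⟨d - 1, by omega⟩ : ℕ) + 1) ∨
    ((π ⟨j + 1, hj⟩ : ℕ) = 0 ∧ (π ⟨0, by omega⟩ : ℕ) = (π ⟨j, by omega⟩ : ℕ) + 1) ∨
    ((π ⟨j + 1, hj⟩ : ℕ) = (π ⟨d - 1, by omega⟩ : ℕ) + 1 ∧ (π ⟨j, by omega⟩ : ℕ) = d - 1)

/-- The Keane condition (idoc): the forward orbits of the interior discontinuities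
`δ_i = leftEnd L i` (`i ≠ 0`) are pairwise disjoint infinite sets. -/
def KeaneCondition {d : ℕ} (π : Equiv.Perm (Fin d)) (L : Fin d → ℝ) : Prop :=
  ∀ i j : Fin d, (i : ℕ) ≠ 0 → (j : ℕ) ≠ 0 → ∀ m n : ℕ,
    (ietMap π L)^[m] (leftEnd L i) = (ietMap π L)^[n] (leftEnd L j) → i = j ∧ m = n

/-- `w` is an allowed block for `T_{L,π}`: some point `x` satisfies
`T^{i+1} x ∈ I_{w i}` for all positions `i` of `w` (i.e. `x ∈ ⋂ T^{-i} I_{a_i}`). -/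
def IsAllowedBlock {d : ℕ} (π : Equiv.Perm (Fin d)) (L : Fin d → ℝ)
    (w : List (Fin d)) : Prop :=
  ∃ x : ℝ, ∀ (i : ℕ) (hi : i < w.length),
    (ietMap π L)^[i + 1] x ∈
      Set.Ico (leftEnd L (w.get ⟨i, hi⟩)) (leftEnd L (w.get ⟨i, hi⟩) + L (w.get ⟨i, hi⟩))

/-- `k`-alphabet mixing: there is `N` such that for any two allowed `k`-blocks `u, v`
and any `n > N` there is an allowed `n`-block beginning with `u` and ending with `v`. -/
def AlphabetMixing {d : ℕ} (π : Equiv.Perm (Fin d)) (L : Fin d → ℝ) (k : ℕ) : Prop :=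
  ∃ N : ℕ, ∀ u v : List (Fin d), u.length = k → v.length = k →
    IsAllowedBlock π L u → IsAllowedBlock π L v →
    ∀ n : ℕ, N < n → ∃ w : List (Fin d),
      w.length = n ∧ IsAllowedBlock π L w ∧ u <+: w ∧ v <:+ w

/-- `π'` is obtained from `π` by the Rauzy move of type `a`. -/
def RauzyMoveA {d : ℕ} [NeZero d] (π π' : Equiv.Perm (Fin d)) : Prop :=
  ∀ j : Fin d,
    ((j : ℕ) ≤ (π.symm (lastIdx d) : ℕ) → π' j = π j) ∧
    ((j : ℕ) = (π.symm (lastIdx d) : ℕ) + 1 → π' j = π (lastIdx d)) ∧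
    ((π.symm (lastIdx d) : ℕ) + 1 < (j : ℕ) →
      π' j = π ⟨(j : ℕ) - 1, lt_of_le_of_lt (Nat.sub_le _ _) j.isLt⟩)

/-- `π'` is obtained from `π` by the Rauzy move of type `b`. -/
def RauzyMoveB {d : ℕ} [NeZero d] (π π' : Equiv.Perm (Fin d)) : Prop :=
  ∀ j : Fin d,
    ((π j : ℕ) ≤ (π (lastIdx d) : ℕ) → π' j = π j) ∧
    ((π (lastIdx d) : ℕ) < (π j : ℕ) → (π j : ℕ) < d - 1 →
      (π' j : ℕ) = (π j : ℕ) + 1) ∧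
    ((π j : ℕ) = d - 1 → (π' j : ℕ) = (π (lastIdx d) : ℕ) + 1)

/-- `π` is in the Rauzy class of `π₀`: reachable by finitely many moves `a`, `b`. -/
def InRauzyClass {d : ℕ} [NeZero d] (π₀ π : Equiv.Perm (Fin d)) : Prop :=
  Relation.ReflTransGen (fun p q => RauzyMoveA p q ∨ RauzyMoveB p q) π₀ π

/-- The permutation `(4321)` on `{1,2,3,4}` (0-indexed: `j ↦ 3 - j`). -/
def perm4321 : Equiv.Perm (Fin 4) := ⟨![3, 2, 1, 0], ![3, 2, 1, 0], by decide, by decide⟩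

/-- The permutation `(4213)` on `{1,2,3,4}`: `1↦4, 2↦2, 3↦1, 4↦3`. -/
def perm4213 : Equiv.Perm (Fin 4) := ⟨![3, 1, 0, 2], ![2, 1, 3, 0], by decide, by decide⟩

/-- The combinatorial data of an interval exchange transformation:
a permutation together with a length vector. -/
structure IET (d : ℕ) where
  perm : Equiv.Perm (Fin d)
  len : Fin d → ℝ

/-- The first step of Rauzy induction on `T` is of type `a`, i.e.
`δ_max = δ_+` (equivalently `l_d < l_{π⁻¹ d}`). -/
def stepA {d : ℕ} [NeZero d] (T : IET d) : Prop :=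
  T.len (lastIdx d) < T.len (T.perm.symm (lastIdx d))

/-- The first step of Rauzy induction on `T` is of type `b`, i.e.
`δ_max = δ_-` (equivalently `l_{π⁻¹ d} < l_d`). -/
def stepB {d : ℕ} [NeZero d] (T : IET d) : Prop :=
  T.len (T.perm.symm (lastIdx d)) < T.len (lastIdx d)

/-- The length vector of `R(T)` after a type `a` step (the first return map of `T`
to `[0, δ_+)`, with intervals in their natural order). -/
noncomputable def lenAfterA {d : ℕ} [NeZero d] (π : Equiv.Perm (Fin d))
    (L : Fin d → ℝ) : Fin d → ℝ := fun j =>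
  if (j : ℕ) < (π.symm (lastIdx d) : ℕ) then L j
  else if (j : ℕ) = (π.symm (lastIdx d) : ℕ) then L j - L (lastIdx d)
  else if (j : ℕ) = (π.symm (lastIdx d) : ℕ) + 1 then L (lastIdx d)
  else L ⟨(j : ℕ) - 1, lt_of_le_of_lt (Nat.sub_le _ _) j.isLt⟩

/-- The length vector of `R(T)` after a type `b` step (the first return map of `T`
to `[0, δ_-)`). -/
noncomputable def lenAfterB {d : ℕ} [NeZero d] (π : Equiv.Perm (Fin d))
    (L : Fin d → ℝ) : Fin d → ℝ := fun j =>
  if j = lastIdx d then L j - L (π.symm (lastIdx d)) else L j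

/-- `T'` is the result of one step of Rauzy induction applied to `T`
(`T' = R(T)`, un-rescaled). -/
def IsRauzyStep {d : ℕ} [NeZero d] (T T' : IET d) : Prop :=
  (stepA T ∧ RauzyMoveA T.perm T'.perm ∧ T'.len = lenAfterA T.perm T.len) ∨
  (stepB T ∧ RauzyMoveB T.perm T'.perm ∧ T'.len = lenAfterB T.perm T.len)

/-- The matrix `M(T,1)` of a type `a` step. -/
def matA {d : ℕ} [NeZero d] (π : Equiv.Perm (Fin d)) : Matrix (Fin d) (Fin d) ℤ :=
  Matrix.of fun i j =>
    if (j : ℕ) ≤ (π.symm (lastIdx d) : ℕ) then (if i = j then 1 else 0)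
    else if i = lastIdx d then (if (j : ℕ) = (π.symm (lastIdx d) : ℕ) + 1 then 1 else 0)
    else if (i : ℕ) = (j : ℕ) - 1 then 1 else 0

/-- The matrix `M(T,1)` of a type `b` step. -/
def matB {d : ℕ} [NeZero d] (π : Equiv.Perm (Fin d)) : Matrix (Fin d) (Fin d) ℤ :=
  Matrix.of fun i j =>
    if i = lastIdx d ∧ j = π.symm (lastIdx d) then 1 else if i = j then 1 else 0

open Classical in
/-- The matrix `M(T,1)` of the first step of Rauzy induction on `T`. -/
noncomputable def stepMat {d : ℕ} [NeZero d] (T : IET d) : Matrix (Fin d) (Fin d) ℤ :=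
  if stepA T then matA T.perm else matB T.perm

/-- A run of `n` steps of Rauzy induction: `seq 0 = T`, `seq (i+1) = R(seq i)`
for `i < n`.  `T` admits `n` steps of Rauzy induction iff such a chain starting
at `T` exists. -/
structure RauzyChain (d : ℕ) [NeZero d] (n : ℕ) where
  seq : ℕ → IET d
  step : ∀ i, i < n → IsRauzyStep (seq i) (seq (i + 1))

/-- The matrix `M(R^a(T), m)` of the steps `a, a+1, …, a+m-1` of a chain. -/
noncomputable def chainMatrixFrom {d n : ℕ} [NeZero d] (c : RauzyChain d n)
    (a m : ℕ) : Matrix (Fin d) (Fin d) ℤ :=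
  ((List.range m).map fun i => stepMat (c.seq (a + i))).prod

/-- The matrix `M(T, m)` of the first `m` steps of a chain starting at `T`. -/
noncomputable def chainMatrix {d n : ℕ} [NeZero d] (c : RauzyChain d n)
    (m : ℕ) : Matrix (Fin d) (Fin d) ℤ :=
  chainMatrixFrom c 0 m

/-- `|C_j(M)|`, the sum of the entries of the `j`-th column of `M`. -/
def colSum {d : ℕ} (M : Matrix (Fin d) (Fin d) ℤ) (j : Fin d) : ℤ := ∑ i, M i j

/-- `M_Δ = M ℝ₊^d ∩ Δ̊_{d-1}`: positive vectors of the cone of `M` lying in the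
interior of the standard simplex. -/
def matSimplex {d : ℕ} (M : Matrix (Fin d) (Fin d) ℤ) : Set (Fin d → ℝ) :=
  {L | (∃ v : Fin d → ℝ, (∀ i, 0 ≤ v i) ∧ L = (M.map (Int.cast : ℤ → ℝ)).mulVec v) ∧
       (∀ i, 0 < L i) ∧ ∑ i, L i = 1}

/-- `u^n`, the `n`-fold concatenation of the word `u` with itself. -/
def wpow {α : Type*} (u : List α) (n : ℕ) : List α := (List.replicate n u).flatten

section Words

variable {α : Type*}

/-- No proper nonempty prefixes of the two rows consist of the same letters. -/
def WordIrreducible (t b : List α) : Prop :=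
  ∀ k, 0 < k → k < t.length → ¬ (t.take k).Perm (b.take k)

lemma WordIrreducible.symm {t b : List α} (hl : t.length = b.length) (hi : WordIrreducible t b) :
    WordIrreducible b t := fun k hk hkb hp => hi k hk (hl ▸ hkb) hp.symm

lemma WordIrreducible.rotate_bot {t : List α} {Z : α} {b u v : List α}
    (hn : (t ++ [Z]).Nodup) (hi : WordIrreducible (t ++ [Z]) (b ++ Z :: (u ++ v))) :
    WordIrreducible (t ++ [Z]) (b ++ Z :: (v ++ u)) := by
  intro k hk hkt hp
  have hkt' : k ≤ t.length := by simp at hkt; omega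
  have hZ : Z ∉ (t ++ [Z]).take k := by
    rw [List.take_append_of_le_length hkt']
    intro hz
    exact (List.nodup_append.1 hn).2.2 Z (List.mem_of_mem_take hz) Z (by simp) rfl
  have hkb : k ≤ b.length := by
    by_contra hlt
    push Not at hlt
    refine hZ (hp.mem_iff.2 ?_)
    obtain ⟨m, hm⟩ : ∃ m, k - b.length = m + 1 := ⟨k - b.length - 1, by omega⟩
    rw [List.take_append, hm]
    simp
  refine hi k hk hkt ?_
  rw [List.take_append_of_le_length hkb] at hp ⊢
  exact hp

variable [DecidableEq α]

/-- One labelled Rauzy step. A state consists of the top row, the bottom row and a weight for each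
letter; the weight of the winning letter is added to the weight of the losing one. -/
inductive WordStep :
    List α × List α × (α → ℤ) → List α × List α × (α → ℤ) → Prop
  | top (t : List α) (A : α) (u : List α) (Z : α) (b : List α) (h : α → ℤ) :
      WordStep (t ++ A :: (u ++ [Z]), b ++ [A], h)
        (t ++ A :: Z :: u, b ++ [A], Function.update h Z (h Z + h A))
  | bot (t : List α) (Z : α) (b : List α) (u : List α) (A : α) (h : α → ℤ) :
      WordStep (t ++ [Z], b ++ Z :: (u ++ [A]), h)
        (t ++ [Z], b ++ Z :: A :: u, Function.update h A (h A + h Z))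

/-- Finitely many labelled Rauzy steps. -/
abbrev WordPath : List α × List α × (α → ℤ) → List α × List α × (α → ℤ) → Prop :=
  Relation.ReflTransGen WordStep

lemma WordStep.swap {s s' : List α × List α × (α → ℤ)} (hs : WordStep s s') :
    WordStep (s.2.1, s.1, s.2.2) (s'.2.1, s'.1, s'.2.2) := by
  cases hs with
  | top t A u Z b h => exact .bot b A t u Z h
  | bot t Z b u A h => exact .top b Z u A t h

lemma WordPath.swap {t b t' b' : List α} {h h' : α → ℤ} (hs : WordPath (t, b, h) (t', b', h')) :
    WordPath (b, t, h) (b', t', h') :=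
  Relation.ReflTransGen.lift
    (fun s : List α × List α × (α → ℤ) => (s.2.1, s.1, s.2.2)) (fun _ _ h => WordStep.swap h)
    _ _ hs

lemma WordStep.perm {s s' : List α × List α × (α → ℤ)} (hs : WordStep s s') :
    s.1.Perm s'.1 ∧ s.2.1.Perm s'.2.1 := by
  cases hs with
  | top t A u Z b h =>
    refine ⟨List.Perm.append_left _ (List.Perm.cons _ ?_), List.Perm.refl _⟩
    exact List.perm_append_singleton _ _
  | bot t Z b u A h =>
    refine ⟨List.Perm.refl _, List.Perm.append_left _ (List.Perm.cons _ ?_)⟩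
    exact List.perm_append_singleton _ _

lemma WordPath.perm {s s' : List α × List α × (α → ℤ)} (hs : WordPath s s') :
    s.1.Perm s'.1 ∧ s.2.1.Perm s'.2.1 := by
  induction hs with
  | refl => exact ⟨List.Perm.refl _, List.Perm.refl _⟩
  | tail _ h ih => exact ⟨ih.1.trans h.perm.1, ih.2.trans h.perm.2⟩

lemma WordStep.pos {s s' : List α × List α × (α → ℤ)} (hs : WordStep s s')
    (hp : ∀ x, 0 < s.2.2 x) : ∀ x, 0 < s'.2.2 x := by
  intro x
  cases hs with
  | top t A u Z b h =>
    have h1 := hp x; have h2 := hp A; have h3 := hp Z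
    simp only [Function.update_apply] at *
    split_ifs <;> linarith
  | bot t Z b u A h =>
    have h1 := hp x; have h2 := hp A; have h3 := hp Z
    simp only [Function.update_apply] at *
    split_ifs <;> linarith

lemma WordPath.pos {s s' : List α × List α × (α → ℤ)} (hs : WordPath s s')
    (hp : ∀ x, 0 < s.2.2 x) : ∀ x, 0 < s'.2.2 x := by
  induction hs with
  | refl => exact hp
  | tail _ h ih => exact h.pos ih

/-- The weights have no common divisor. -/
def Primitive (h : α → ℤ) : Prop := ∀ g : ℤ, (∀ x, g ∣ h x) → IsUnit g

lemma Primitive.update {h : α → ℤ} (hp : Primitive h) {x y : α} (hxy : x ≠ y) :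
    Primitive (Function.update h x (h x + h y)) := by
  intro g hg
  have hy : g ∣ h y := by simpa [hxy.symm] using hg y
  refine hp g fun z => ?_
  by_cases hz : z = x
  · subst hz
    have := hg z
    simp only [Function.update_self] at this
    exact (dvd_add_left hy).1 this
  · simpa [hz] using hg z

lemma WordStep.primitive {s s' : List α × List α × (α → ℤ)} (hs : WordStep s s')
    (ht : s.1.Nodup) (hb : s.2.1.Nodup) (hp : Primitive s.2.2) : Primitive s'.2.2 := by
  cases hs with
  | top t A u Z b h => exact hp.update (by rintro rfl; simp [List.nodup_append] at ht)
  | bot t Z b u A h => exact hp.update (by rintro rfl; simp [List.nodup_append] at hb)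

lemma WordPath.primitive {s s' : List α × List α × (α → ℤ)} (hs : WordPath s s')
    (ht : s.1.Nodup) (hb : s.2.1.Nodup) (hp : Primitive s.2.2) : Primitive s'.2.2 := by
  induction hs with
  | refl => exact hp
  | tail h0 h ih =>
    exact h.primitive ((WordPath.perm h0).1.nodup_iff.1 ht) ((WordPath.perm h0).2.nodup_iff.1 hb) ih

/-- Rotating the letters behind the last bottom letter, keeping track of the weights. -/
lemma wordPath_rotate_top (t : List α) (A : α) (u v b : List α) (h : α → ℤ)
    (hn : (A :: v).Nodup) :
    WordPath (t ++ A :: (u ++ v), b ++ [A], h)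
      (t ++ A :: (v ++ u), b ++ [A], fun x => if x ∈ v then h x + h A else h x) := by
  induction v using List.reverseRecOn generalizing u h with
  | nil => simpa using Relation.ReflTransGen.refl
  | append_singleton v z ih =>
    have hn' : A ∉ v ∧ A ≠ z ∧ z ∉ v ∧ v.Nodup := by
      simp only [List.nodup_cons, List.mem_append, List.mem_singleton, not_or,
        List.nodup_append] at hn
      refine ⟨hn.1.1, hn.1.2, fun hz => ?_, hn.2.1⟩
      exact hn.2.2.2 z hz z rfl rfl
    have h1 := WordStep.top t A (u ++ v) z b h
    have h2 := ih (z :: u) (Function.update h z (h z + h A)) (by simp [hn'])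
    rw [← List.append_assoc]
    refine Relation.ReflTransGen.head h1 ?_
    convert h2 using 3
    · simp
    · simp
    · funext x
      by_cases hx : x = z
      · subst hx; simp [hn']
      · simp [hx, hn'.2.1]

lemma wordPath_rotate_bot (t : List α) (Z : α) (b u v : List α) (h : α → ℤ)
    (hn : (Z :: v).Nodup) :
    WordPath (t ++ [Z], b ++ Z :: (u ++ v), h)
      (t ++ [Z], b ++ Z :: (v ++ u), fun x => if x ∈ v then h x + h Z else h x) :=
  (wordPath_rotate_top b Z u v t h hn).swap

/-- Iterating a full rotation behind the last bottom letter. -/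
lemma wordPath_cycle_top (t : List α) (A : α) (v b : List α) (h : α → ℤ)
    (hn : (A :: v).Nodup) (k : ℕ) :
    WordPath (t ++ A :: v, b ++ [A], h)
      (t ++ A :: v, b ++ [A], fun x => if x ∈ v then h x + k * h A else h x) := by
  induction k with
  | zero => simpa using Relation.ReflTransGen.refl
  | succ k ih =>
    refine Relation.ReflTransGen.trans ih ?_
    have h1 := wordPath_rotate_top t A [] v b
      (fun x => if x ∈ v then h x + k * h A else h x) hn
    have hA : A ∉ v := (List.nodup_cons.1 hn).1
    simp only [List.nil_append, List.append_nil, hA, if_false] at h1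
    convert h1 using 3
    funext x
    by_cases hx : x ∈ v
    · simp [hx]; ring
    · simp [hx]

lemma wordPath_cycle_bot (t : List α) (Z : α) (b v : List α) (h : α → ℤ)
    (hn : (Z :: v).Nodup) (k : ℕ) :
    WordPath (t ++ [Z], b ++ Z :: v, h)
      (t ++ [Z], b ++ Z :: v, fun x => if x ∈ v then h x + k * h Z else h x) :=
  (wordPath_cycle_top b Z v t h hn k).swap

/-- The pair of rows `(t', b')` is reachable from `(t, b)`, whatever the weights. -/
def Conn (t b t' b' : List α) : Prop :=
  ∀ h : α → ℤ, ∃ h' : α → ℤ, WordPath (t, b, h) (t', b', h')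

lemma Conn.refl (t b : List α) : Conn t b t b := fun h => ⟨h, .refl⟩

lemma Conn.trans {t b t' b' t'' b'' : List α} (h₁ : Conn t b t' b') (h₂ : Conn t' b' t'' b'') :
    Conn t b t'' b'' := fun h => by
  obtain ⟨h', p⟩ := h₁ h
  obtain ⟨h'', q⟩ := h₂ h'
  exact ⟨h'', p.trans q⟩

lemma Conn.swap {t b t' b' : List α} (h₁ : Conn t b t' b') : Conn b t b' t' := fun h => by
  obtain ⟨h', p⟩ := h₁ h
  exact ⟨h', p.swap⟩

lemma Conn.perm {t b t' b' : List α} (h₁ : Conn t b t' b') : t.Perm t' ∧ b.Perm b' := by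
  obtain ⟨h', p⟩ := h₁ 0
  exact WordPath.perm p

lemma conn_rotate_top (t : List α) (A : α) (u v b : List α) :
    Conn (t ++ A :: (u ++ v)) (b ++ [A]) (t ++ A :: (v ++ u)) (b ++ [A]) := by
  induction v using List.reverseRecOn generalizing u with
  | nil => simpa using Conn.refl _ _
  | append_singleton v z ih =>
    rw [← List.append_assoc]
    refine Conn.trans (fun h => ⟨_, .single (.top t A (u ++ v) z b h)⟩) ?_
    simpa using ih (z :: u)

lemma conn_rotate_bot (t : List α) (Z : α) (b u v : List α) :
    Conn (t ++ [Z]) (b ++ Z :: (u ++ v)) (t ++ [Z]) (b ++ Z :: (v ++ u)) :=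
  (conn_rotate_top b Z u v t).swap

/-- If `X` precedes `W` in both rows of a standard pair, then the two blocks ending with `X` and `W`
may be exchanged simultaneously in both rows. -/
lemma conn_exchange (A Z X W : α) (x₁ x₂ x₃ y₁ y₂ y₃ : List α) :
    Conn (A :: (x₁ ++ X :: (x₂ ++ W :: (x₃ ++ [Z])))) (Z :: (y₁ ++ X :: (y₂ ++ W :: (y₃ ++ [A]))))
      (A :: (x₂ ++ W :: (x₁ ++ X :: (x₃ ++ [Z])))) (Z :: (y₂ ++ W :: (y₁ ++ X :: (y₃ ++ [A])))) := by
  have h1 := conn_rotate_top [] A (x₁ ++ [X]) (x₂ ++ W :: (x₃ ++ [Z]))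
    (Z :: (y₁ ++ X :: (y₂ ++ W :: y₃)))
  have h2 := conn_rotate_bot (A :: (x₂ ++ W :: (x₃ ++ Z :: x₁))) X (Z :: y₁) (y₂ ++ [W]) (y₃ ++ [A])
  have h3 := conn_rotate_top (A :: x₂) W (x₃ ++ [Z]) (x₁ ++ [X]) (Z :: (y₁ ++ X :: (y₃ ++ A :: y₂)))
  have h4 := conn_rotate_bot (A :: (x₂ ++ W :: (x₁ ++ X :: x₃))) Z [] (y₁ ++ X :: (y₃ ++ [A]))
    (y₂ ++ [W])
  simp only [List.append_assoc, List.cons_append, List.nil_append] at h1 h2 h3 h4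
  exact ((h1.trans h2).trans h3).trans h4

/-- Every irreducible pair of rows is connected to a standard one. -/
lemma exists_standard (t₀ : List α) (Z : α) (b₁ b₂ : List α) (ht : (t₀ ++ [Z]).Nodup)
    (hp : (t₀ ++ [Z]).Perm (b₁ ++ Z :: b₂)) (ht₀ : t₀ ≠ [])
    (hi : WordIrreducible (t₀ ++ [Z]) (b₁ ++ Z :: b₂)) :
    ∃ A Z' x y, Conn (t₀ ++ [Z]) (b₁ ++ Z :: b₂) (A :: (x ++ [Z'])) (Z' :: (y ++ [A])) := by
  induction hk : b₁.length using Nat.strong_induction_on generalizing t₀ Z b₁ b₂ with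
  | _ k ih =>
  have hZt : Z ∉ t₀ := by
    intro hz
    simp only [List.nodup_append] at ht
    exact ht.2.2 Z hz Z (by simp) rfl
  have hlen : t₀.length = b₁.length + b₂.length := by
    have := hp.length_eq
    simp at this; omega
  rcases b₁ with _ | ⟨e, b₁⟩
  · obtain ⟨A, x, rfl⟩ := List.exists_cons_of_ne_nil ht₀
    have hA : A ∈ b₂ := by
      have : A ∈ [] ++ Z :: b₂ := hp.mem_iff.1 (by simp)
      have hne : A ≠ Z := by rintro rfl; simp at hZt
      simpa [hne] using this
    obtain ⟨c, c', rfl⟩ := List.append_of_mem hA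
    have := conn_rotate_bot (A :: x) Z [] (c ++ [A]) c'
    exact ⟨A, Z, x, c' ++ c, by simpa using this⟩
  · set b := e :: b₁ with hb
    have hb2 : b₂ ≠ [] := by
      rintro rfl
      refine hi b.length (by simp [hb]) (by simp [hlen]) ?_
      rw [List.take_append_of_le_length (by simpa using hlen.ge),
        List.take_of_length_le (by simpa using hlen.le), List.take_left]
      exact (List.perm_append_right_iff [Z]).1 hp
    have hlt : b.length < t₀.length := by
      have := List.length_pos_iff.2 hb2
      omega
    have hex : ∃ j ∈ (t₀ ++ [Z]).take b.length, j ∉ b := by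
      by_contra hcon
      push Not at hcon
      refine hi b.length (by simp [hb]) (by simp; omega) ?_
      rw [List.take_left]
      refine ((ht.sublist (List.take_sublist _ _)).subperm hcon).perm_of_length_le ?_
      simp; omega
    obtain ⟨j, hj, hjb⟩ := hex
    rw [List.take_append_of_le_length hlt.le] at hj
    have hjt : j ∈ t₀ := List.mem_of_mem_take hj
    have hjZ : j ≠ Z := by rintro rfl; exact hZt hjt
    have hjb2 : j ∈ b₂ := by
      have : j ∈ b ++ Z :: b₂ := hp.mem_iff.1 (by simp [hjt])
      simpa [hjb, hjZ] using this
    obtain ⟨c, c', rfl⟩ := List.append_of_mem hjb2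
    obtain ⟨s, s', hs⟩ := List.append_of_mem hj
    have htt : t₀ ++ [Z] = s ++ j :: (s' ++ t₀.drop b.length ++ [Z]) := by
      conv_lhs => rw [← List.take_append_drop b.length t₀, hs]
      simp
    have hslen : s.length < b.length := by
      have h1 := congrArg List.length hs
      simp only [List.length_take, List.length_append, List.length_cons] at h1
      omega
    have hconn := conn_rotate_bot t₀ Z b (c ++ [j]) c'
    have hi' : WordIrreducible (t₀ ++ [Z]) (b ++ Z :: (c' ++ (c ++ [j]))) :=
      WordIrreducible.rotate_bot ht (by simpa using hi)
    have e1 : b ++ Z :: (c ++ j :: c') = b ++ Z :: (c ++ [j] ++ c') := by simp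
    have e2 : b ++ Z :: (c' ++ (c ++ [j])) = (b ++ Z :: (c' ++ c)) ++ [j] := by simp
    rw [e1] at hp ⊢
    have hp' := hp.trans hconn.perm.2
    rw [e2] at hi' hconn hp'
    rw [htt] at hp' hi' ht
    obtain ⟨A, Z', x, y, hc⟩ := ih s.length (hk ▸ hslen) (b ++ Z :: (c' ++ c)) j s
      (s' ++ t₀.drop b.length ++ [Z]) (hp'.nodup_iff.1 ht) hp'.symm (by simp)
      (hi'.symm hp'.length_eq) rfl
    refine ⟨Z', A, y, x, hconn.trans ?_⟩
    rw [htt]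
    exact hc.swap

/-- The standard pair `(A … Q R Z, Z … R Q A)`, or a standard pair `(A … P Q R Z, Z … R Q P … A)`,
is connected to every standard pair whose inner words end with distinct letters. -/
lemma exists_reversed_tail (A Z Q R : α) (x₁ x₂ y₁ y₂ : List α)
    (ht : (A :: (x₁ ++ Q :: (x₂ ++ [R, Z]))).Nodup)
    (hp : (A :: (x₁ ++ Q :: (x₂ ++ [R, Z]))).Perm (Z :: (y₁ ++ R :: (y₂ ++ [Q, A])))) :
    (∃ Q' R' x y, Conn (A :: (x₁ ++ Q :: (x₂ ++ [R, Z]))) (Z :: (y₁ ++ R :: (y₂ ++ [Q, A])))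
        (A :: (x ++ [Q', R', Z])) (Z :: (y ++ [R', Q', A]))) ∨
      ∃ P' Q' R' x y y', Conn (A :: (x₁ ++ Q :: (x₂ ++ [R, Z])))
        (Z :: (y₁ ++ R :: (y₂ ++ [Q, A])))
        (A :: (x ++ [P', Q', R', Z])) (Z :: (y ++ R' :: Q' :: P' :: (y' ++ [A]))) := by
  induction hk : x₂.length + y₂.length using Nat.strong_induction_on
    generalizing Q R x₁ x₂ y₁ y₂ with
  | _ k ih =>
  have hb := hp.nodup_iff.1 ht
  have hmem : ∀ z, z ∈ A :: (x₁ ++ Q :: (x₂ ++ [R, Z])) ↔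
    z ∈ Z :: (y₁ ++ R :: (y₂ ++ [Q, A])) := fun z => hp.mem_iff
  -- reduction to a shorter pair
  have step : ∀ (Q' R' : α) (x₁' x₂' y₁' y₂' : List α),
      x₂'.length + y₂'.length < k →
      Conn (A :: (x₁ ++ Q :: (x₂ ++ [R, Z]))) (Z :: (y₁ ++ R :: (y₂ ++ [Q, A])))
        (A :: (x₁' ++ Q' :: (x₂' ++ [R', Z]))) (Z :: (y₁' ++ R' :: (y₂' ++ [Q', A]))) →
      (∃ Q' R' x y, Conn (A :: (x₁ ++ Q :: (x₂ ++ [R, Z]))) (Z :: (y₁ ++ R :: (y₂ ++ [Q, A])))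
        (A :: (x ++ [Q', R', Z])) (Z :: (y ++ [R', Q', A]))) ∨
      ∃ P' Q' R' x y y', Conn (A :: (x₁ ++ Q :: (x₂ ++ [R, Z])))
        (Z :: (y₁ ++ R :: (y₂ ++ [Q, A])))
        (A :: (x ++ [P', Q', R', Z])) (Z :: (y ++ R' :: Q' :: P' :: (y' ++ [A]))) := by
    intro Q' R' x₁' x₂' y₁' y₂' hlt hc
    rcases ih _ hlt Q' R' x₁' x₂' y₁' y₂' (hc.perm.1.nodup_iff.1 ht)
      (hc.perm.1.symm.trans (hp.trans hc.perm.2)) rfl with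
      ⟨Q'', R'', x, y, h⟩ | ⟨P'', Q'', R'', x, y, y', h⟩
    · exact .inl ⟨Q'', R'', x, y, hc.trans h⟩
    · exact .inr ⟨P'', Q'', R'', x, y, y', hc.trans h⟩
  by_cases h₁ : ∃ X ∈ x₂, X ∈ y₁
  · obtain ⟨X, hX, hX'⟩ := h₁
    obtain ⟨s, s', rfl⟩ := List.append_of_mem hX
    obtain ⟨r, r', rfl⟩ := List.append_of_mem hX'
    have := conn_exchange A Z X R (x₁ ++ Q :: s) s' [] r r' (y₂ ++ [Q])
    refine step Q X (s' ++ R :: x₁) s (r' ++ R :: r) y₂ ?_ (by simpa using this)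
    simp at hk; omega
  by_cases h₂ : ∃ X ∈ y₂, X ∈ x₁
  · obtain ⟨X, hX, hX'⟩ := h₂
    obtain ⟨s, s', rfl⟩ := List.append_of_mem hX
    obtain ⟨r, r', rfl⟩ := List.append_of_mem hX'
    have := conn_exchange A Z X Q r r' (x₂ ++ [R]) (y₁ ++ R :: s) s' []
    refine step X R (r' ++ Q :: r) x₂ (s' ++ Q :: y₁) s ?_ (by simpa using this)
    simp at hk; omega
  by_cases h₃ : ∃ X W, [X, W].Sublist x₂ ∧ [X, W].Sublist y₂
  · obtain ⟨X, W, hx, hy⟩ := h₃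
    obtain ⟨s₁, s', rfl, h1, h2⟩ := List.cons_sublist_iff.1 hx
    obtain ⟨r₁, r', rfl, h3, h4⟩ := List.cons_sublist_iff.1 hy
    obtain ⟨a, b, rfl⟩ := List.append_of_mem h1
    obtain ⟨e, f, rfl⟩ := List.append_of_mem h3
    obtain ⟨a', b', rfl⟩ := List.append_of_mem (List.singleton_sublist.1 h2)
    obtain ⟨e', f', rfl⟩ := List.append_of_mem (List.singleton_sublist.1 h4)
    have := conn_exchange A Z X W (x₁ ++ Q :: a) (b ++ a') (b' ++ [R]) (y₁ ++ R :: e) (f ++ e')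
      (f' ++ [Q])
    refine step Q R (b ++ a' ++ W :: x₁) (a ++ X :: b') (f ++ e' ++ W :: y₁) (e ++ X :: f') ?_
      (by simpa using this)
    simp at hk ⊢; omega
  push Not at h₁ h₂ h₃
  have hxy : ∀ z ∈ x₂, z ∈ y₂ := by
    intro z hz
    have h1 := h₁ z hz
    have h2 := (hmem z).1 (by simp [hz])
    simp [List.nodup_append] at ht h2
    grind
  have hyx : ∀ z ∈ y₂, z ∈ x₂ := by
    intro z hz
    have h1 := h₂ z hz
    have h2 := (hmem z).2 (by simp [hz])
    simp [List.nodup_append] at hb h2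
    grind
  have hnx : x₂.Nodup := by
    simp only [List.nodup_cons, List.nodup_append] at ht; exact ht.2.2.1.2.1
  have hny : y₂.Nodup := by
    simp only [List.nodup_cons, List.nodup_append] at hb; exact hb.2.2.1.2.1
  rcases List.eq_nil_or_concat' x₂ with rfl | ⟨x', w, rfl⟩
  · have : y₂ = [] := List.eq_nil_iff_forall_not_mem.2 fun z hz => by simpa using hyx z hz
    subst this
    exact .inl ⟨Q, R, x₁, y₁, by simpa using Conn.refl _ _⟩
  have hsub : ∀ (a b c f : List α) (v z : α), x' ++ [w] = a ++ v :: b → y₂ = c ++ v :: f →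
      z ∈ c → z ∉ a := by
    intro a b c f v z h1 h2 hzc hza
    refine h₃ z v ?_ ?_
    · rw [h1]; exact (List.singleton_sublist.2 hza).append (by simp : [v].Sublist (v :: b))
    · rw [h2]; exact (List.singleton_sublist.2 hzc).append (by simp : [v].Sublist (v :: f))
  obtain ⟨c, f, rfl⟩ := List.append_of_mem (hxy w (by simp))
  have hc : c = [] := by
    refine List.eq_nil_iff_forall_not_mem.2 fun z hz => ?_
    have h1 := hsub x' [] c f w z rfl rfl hz
    have h2 := hyx z (by simp [hz])
    have h3 : z ≠ w := by
      rintro rfl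
      simp only [List.nodup_append] at hny
      exact hny.2.2 z hz z (by simp) rfl
    simp [h1, h3] at h2
  subst hc
  rcases List.eq_nil_or_concat' x' with rfl | ⟨x'', v, rfl⟩
  · have : f = [] := by
      refine List.eq_nil_iff_forall_not_mem.2 fun z hz => ?_
      have h2 := hyx z (by simp [hz])
      simp at hny h2
      exact hny.1 (h2 ▸ hz)
    subst this
    exact .inr ⟨Q, w, R, x₁, y₁, [], by simpa using Conn.refl _ _⟩
  · have hv : v ∈ f := by
      have h1 := hxy v (by simp)
      have h2 : v ≠ w := by
        rintro rfl
        simp [List.nodup_append] at hnx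
      simpa [h2] using h1
    obtain ⟨e, f', rfl⟩ := List.append_of_mem hv
    have he : e = [] := by
      refine List.eq_nil_iff_forall_not_mem.2 fun z hz => ?_
      have h1 := hsub x'' [w] (w :: e) f' v z (by simp) rfl (by simp [hz])
      have h2 := hyx z (by simp [hz])
      have h3 : z ≠ w := by rintro rfl; simp [hz] at hny
      have h4 : z ≠ v := by
        rintro rfl
        simp [List.nodup_append] at hny
        grind
      simp [h1, h3, h4] at h2
    subst he
    exact .inr ⟨v, w, R, x₁ ++ Q :: x'', y₁, f' ++ [Q], by simpa using Conn.refl _ _⟩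

/-- If `a` and `b` are coprime then some `a + k b` is coprime to `N`. -/
lemma exists_isCoprime_add_mul {a b N : ℤ} (hb : 0 < b) (hN : 0 < N) (hab : IsCoprime a b) :
    ∃ k : ℕ, IsCoprime (a + k * b) N := by
  obtain ⟨p, hlt, hprime, hmod⟩ := Nat.forall_exists_prime_gt_and_zmodEq
    (N.toNat + a.natAbs) (q := b.toNat) (a := a) (by omega) (by rwa [Int.toNat_of_nonneg hb.le])
  rw [Int.toNat_of_nonneg hb.le] at hmod
  obtain ⟨m, hm⟩ := hmod.symm.dvd
  have hm0 : 0 ≤ m := by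
    by_contra hneg
    have : b * m < 0 := mul_neg_of_pos_of_neg hb (by omega)
    omega
  refine ⟨m.toNat, ?_⟩
  rw [Int.toNat_of_nonneg hm0, show a + m * b = (p : ℤ) by linarith]
  have : p.Coprime N.toNat := (Nat.Prime.coprime_iff_not_dvd hprime).2 fun hd => by
    have := Nat.le_of_dvd (by omega) hd
    omega
  have := Nat.isCoprime_iff_coprime.2 this
  rwa [Int.toNat_of_nonneg hN.le] at this

lemma exists_add_mul_dvd {a b N : ℤ} (hb : 0 < b) (hN : 0 < N) :
    ∃ k : ℕ, ∀ g : ℤ, g ∣ a + k * b → g ∣ N → g ∣ b := by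
  have hg : (0 : ℤ) < (Int.gcd a b : ℤ) := by exact_mod_cast Int.gcd_pos_of_ne_zero_right a hb.ne'
  obtain ⟨a', ha⟩ := Int.gcd_dvd_left a b
  obtain ⟨b', hb'⟩ := Int.gcd_dvd_right a b
  set e : ℤ := (Int.gcd a b : ℤ)
  have hcop : IsCoprime a' b' := by
    have h1 := Int.gcd_eq_gcd_ab a b
    refine ⟨Int.gcdA a b, Int.gcdB a b, ?_⟩
    have : e * (Int.gcdA a b * a' + Int.gcdB a b * b') = e * 1 := by
      calc _ = (e * a') * Int.gcdA a b + (e * b') * Int.gcdB a b := by ring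
        _ = e * 1 := by rw [← ha, ← hb', mul_one]; exact h1.symm
    exact mul_left_cancel₀ hg.ne' this
  have hb'pos : 0 < b' := by
    rw [hb'] at hb
    exact pos_of_mul_pos_right hb hg.le
  obtain ⟨k, hk⟩ := exists_isCoprime_add_mul hb'pos hN hcop
  refine ⟨k, fun g h1 h2 => ?_⟩
  have h3 : a + k * b = (a' + k * b') * e := by rw [ha, hb']; ring
  rw [h3] at h1
  have h4 : g ∣ e := (hk.of_isCoprime_of_dvd_right h2).symm.dvd_of_dvd_mul_left h1
  rw [hb']
  exact h4.mul_right b'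

/-- A loop at a standard pair after which the common divisors of the weights of the two extreme
letters divide the weight of a given letter `X`. -/
lemma exists_absorb (A Z X : α) (x₁ x₂ y₁ y₂ : List α) (h : α → ℤ)
    (ht : (A :: (x₁ ++ X :: (x₂ ++ [Z]))).Nodup) (hb : (Z :: (y₁ ++ X :: (y₂ ++ [A]))).Nodup)
    (hpos : ∀ x, 0 < h x) :
    ∃ h', WordPath (A :: (x₁ ++ X :: (x₂ ++ [Z])), Z :: (y₁ ++ X :: (y₂ ++ [A])), h)
        (A :: (x₁ ++ X :: (x₂ ++ [Z])), Z :: (y₁ ++ X :: (y₂ ++ [A])), h') ∧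
      ∀ g, g ∣ h' A → g ∣ h' Z → g ∣ h X ∧ ∀ Y, g ∣ h' Y - h Y := by
  obtain ⟨k, hk⟩ := exists_add_mul_dvd (a := h A) (hpos X) (add_pos (hpos Z) (hpos A))
  simp [List.nodup_append] at ht hb
  have p1 := wordPath_rotate_top [] A (x₁ ++ [X]) (x₂ ++ [Z]) (Z :: (y₁ ++ X :: y₂)) h
    (by simp [List.nodup_append]; grind)
  set h1 : α → ℤ := fun x => if x ∈ x₂ ++ [Z] then h x + h A else h x with h1_def
  have p2 := wordPath_cycle_bot (A :: (x₂ ++ Z :: x₁)) X (Z :: y₁) (y₂ ++ [A]) h1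
    (by simp [List.nodup_append]; grind) k
  set h2 : α → ℤ := fun x => if x ∈ y₂ ++ [A] then h1 x + k * h1 X else h1 x with h2_def
  have p3 := wordPath_rotate_top [] A (x₂ ++ [Z]) (x₁ ++ [X]) (Z :: (y₁ ++ X :: y₂)) h2
    (by simp [List.nodup_append]; grind)
  set h3 : α → ℤ := fun x => if x ∈ x₁ ++ [X] then h2 x + h2 A else h2 x with h3_def
  simp only [List.append_assoc, List.cons_append, List.nil_append] at p1 p2 p3
  refine ⟨h3, (p1.trans p2).trans p3, fun g hA hZ => ?_⟩
  have e1 : h1 X = h X := by simp only [h1_def]; rw [if_neg]; simp; grind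
  have e2 : h1 A = h A := by simp only [h1_def]; rw [if_neg]; simp; grind
  have e3 : h2 A = h A + k * h X := by simp [h2_def, e1, e2]
  have e4 : h2 Z = h Z + h A := by
    simp only [h2_def]; rw [if_neg]
    · simp [h1_def]
    · simp; grind
  have e5 : h3 A = h A + k * h X := by
    simp only [h3_def]; rw [if_neg, e3]; simp; grind
  have e6 : h3 Z = h Z + h A := by
    simp only [h3_def]; rw [if_neg, e4]; simp; grind
  have gX : g ∣ h X := hk g (e5 ▸ hA) (e6 ▸ hZ)
  have gA : g ∣ h A := (dvd_add_left (gX.mul_left _)).1 (e5 ▸ hA)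
  refine ⟨gX, fun Y => ?_⟩
  have g1 : g ∣ h1 Y - h Y := by
    simp only [h1_def]; split_ifs <;> simp [gA]
  have g2 : g ∣ h2 Y - h1 Y := by
    simp only [h2_def]; split_ifs <;> simp [e1, gX.mul_left]
  have g3 : g ∣ h3 Y - h2 Y := by
    rw [e5, ← e3] at hA
    simp only [h3_def]; split_ifs <;> simp [hA]
  rw [show h3 Y - h Y = h3 Y - h2 Y + (h2 Y - h1 Y) + (h1 Y - h Y) by ring]
  exact (g3.add g2).add g1

lemma exists_absorb_list (A Z : α) (x y l : List α) (h : α → ℤ)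
    (ht : (A :: (x ++ [Z])).Nodup) (hp : (A :: (x ++ [Z])).Perm (Z :: (y ++ [A])))
    (hpos : ∀ x, 0 < h x) (hl : ∀ X ∈ l, X ∈ x) :
    ∃ h', WordPath (A :: (x ++ [Z]), Z :: (y ++ [A]), h) (A :: (x ++ [Z]), Z :: (y ++ [A]), h') ∧
      ∀ g, g ∣ h' A → g ∣ h' Z → (∀ X ∈ l, g ∣ h X) ∧ ∀ Y, g ∣ h' Y - h Y := by
  induction l generalizing h with
  | nil => exact ⟨h, .refl, by simp⟩
  | cons X l ih =>
    have hX : X ∈ x := hl X (by simp)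
    have hb := hp.nodup_iff.1 ht
    have hX' : X ∈ y := by
      have h2 := hp.mem_iff.1 (show X ∈ A :: (x ++ [Z]) by simp [hX])
      simp [List.nodup_append] at ht h2
      grind
    obtain ⟨x₁, x₂, rfl⟩ := List.append_of_mem hX
    obtain ⟨y₁, y₂, rfl⟩ := List.append_of_mem hX'
    obtain ⟨h1, p1, d1⟩ := exists_absorb A Z X x₁ x₂ y₁ y₂ h (by simpa using ht) (by simpa using hb)
      hpos
    obtain ⟨h2, p2, d2⟩ := ih h1 (WordPath.pos p1 hpos) fun Y hY => hl Y (by simp [hY])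
    refine ⟨h2, Relation.ReflTransGen.trans (by simpa using p1) p2, fun g gA gZ => ?_⟩
    obtain ⟨i1, i2⟩ := d2 g gA gZ
    obtain ⟨j1, j2⟩ := d1 g ((dvd_sub_right gA).1 (i2 A)) ((dvd_sub_right gZ).1 (i2 Z))
    refine ⟨?_, fun Y => ?_⟩
    · rintro Y hY
      rcases List.mem_cons.1 hY with rfl | hY
      · exact j1
      · exact (dvd_sub_right (i1 Y hY)).1 (j2 Y)
    · rw [show h2 Y - h Y = h2 Y - h1 Y + (h1 Y - h Y) by ring]
      exact (i2 Y).add (j2 Y)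

/-- A nontrivial loop at a standard pair after which the weights of `Z` and of a given inner letter
are coprime. -/
lemma exists_coprime_weights (A Z Q : α) (x y : List α) (h : α → ℤ)
    (ht : (A :: (x ++ [Z])).Nodup) (hp : (A :: (x ++ [Z])).Perm (Z :: (y ++ [A])))
    (hall : ∀ X, X ∈ A :: (x ++ [Z])) (hpos : ∀ x, 0 < h x) (hprim : Primitive h) (hQ : Q ∈ x) :
    ∃ h', Relation.TransGen WordStep (A :: (x ++ [Z]), Z :: (y ++ [A]), h)
        (A :: (x ++ [Z]), Z :: (y ++ [A]), h') ∧ IsCoprime (h' Q) (h' Z) := by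
  obtain ⟨h1, p1, d1⟩ := exists_absorb_list A Z x y x h ht hp hpos fun _ hX => hX
  have pos1 : ∀ x, 0 < h1 x := WordPath.pos p1 hpos
  have hAZ : IsCoprime (h1 Z) (h1 A) := by
    rw [Int.isCoprime_iff_gcd_eq_one]
    have gZ : (Int.gcd (h1 Z) (h1 A) : ℤ) ∣ h1 Z := Int.gcd_dvd_left _ _
    have gA : (Int.gcd (h1 Z) (h1 A) : ℤ) ∣ h1 A := Int.gcd_dvd_right _ _
    obtain ⟨i1, i2⟩ := d1 _ gA gZ
    have hu := hprim (Int.gcd (h1 Z) (h1 A)) fun X => by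
      have hX := hall X
      simp only [List.mem_cons, List.mem_append, List.not_mem_nil, or_false] at hX
      rcases hX with rfl | hX | rfl
      · exact (dvd_sub_right gA).1 (i2 _)
      · exact i1 X hX
      · exact (dvd_sub_right gZ).1 (i2 _)
    simpa [Int.isUnit_iff_natAbs_eq] using hu
  have hb := hp.nodup_iff.1 ht
  have hQ' : Q ∈ y := by
    have h2 := hp.mem_iff.1 (show Q ∈ A :: (x ++ [Z]) by simp [hQ])
    simp [List.nodup_append] at ht h2
    grind
  have p2 := wordPath_cycle_bot (A :: x) Z [] (y ++ [A]) h1 hb 1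
  set h2 : α → ℤ := fun X => if X ∈ y ++ [A] then h1 X + (1 : ℕ) * h1 Z else h1 X with h2_def
  have eA : h2 A = h1 A + h1 Z := by simp [h2_def]
  have eQ : h2 Q = h1 Q + h1 Z := by simp [h2_def, hQ']
  have eZ : h2 Z = h1 Z := by
    simp only [h2_def]; rw [if_neg (List.nodup_cons.1 hb).1]
  have p2' : Relation.TransGen WordStep (A :: (x ++ [Z]), Z :: (y ++ [A]), h1)
      (A :: (x ++ [Z]), Z :: (y ++ [A]), h2) := by
    rcases Relation.reflTransGen_iff_eq_or_transGen.1 p2 with he | hT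
    · have : h2 A = h1 A := congrFun (congrArg (fun s => s.2.2) he) A
      have := pos1 Z
      omega
    · exact hT
  obtain ⟨k, hk⟩ := exists_isCoprime_add_mul (a := h2 Z) (b := h2 A) (N := h1 Q)
    (by have := pos1 A; have := pos1 Z; omega) (pos1 Q) (by
      rw [eZ, eA]; simpa using hAZ.add_mul_left_right 1)
  have p3 := wordPath_cycle_top [] A (x ++ [Z]) (Z :: y) h2 ht k
  refine ⟨_, (Relation.TransGen.trans_right p1 p2').trans_left p3, ?_⟩
  simp only [List.mem_append, hQ, List.mem_singleton, true_or, or_true, if_true]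
  rw [eQ]
  rw [eZ] at hk ⊢
  have := hk.add_mul_left_right 1
  rw [show h1 Q + h1 Z + k * h2 A = h1 Q + (h1 Z + k * h2 A) * 1 by ring]
  exact this.symm

end Words

section Paths

variable {d : ℕ}

lemma isIrreducible_iff {π : Equiv.Perm (Fin d)} :
    IsIrreducible π ↔ ∀ k : ℕ, 0 < k → k < d → ∃ j : Fin d, (j : ℕ) < k ∧ k ≤ (π j : ℕ) := by
  refine forall_congr' fun k => forall_congr' fun hk => forall_congr' fun hkd => ?_
  constructor
  · intro hne
    by_contra hcon
    push Not at hcon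
    refine hne (Set.Finite.eq_of_subset_of_card_le (Set.toFinite _) ?_ ?_)
    · rintro _ ⟨j, hj, rfl⟩
      exact hcon j hj
    · rw [Nat.card_image_of_injective π.injective]
  · rintro ⟨j, hj, hkj⟩ he
    have : π j ∈ {j : Fin d | (j : ℕ) < k} := he ▸ Set.mem_image_of_mem π hj
    exact absurd this (by simpa using hkj)

lemma map_mul_mulVec (M N : Matrix (Fin d) (Fin d) ℤ) (v : Fin d → ℝ) :
    ((M * N).map (Int.cast : ℤ → ℝ)).mulVec v =
      (M.map (Int.cast : ℤ → ℝ)).mulVec ((N.map (Int.cast : ℤ → ℝ)).mulVec v) := by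
  rw [Matrix.mulVec_mulVec]
  congr 1
  exact Matrix.map_mul (f := Int.castRingHom ℝ)

/-- `π` as a function on natural numbers. -/
def natVal (π : Equiv.Perm (Fin d)) (j : ℕ) : ℕ := if h : j < d then π ⟨j, h⟩ else 0

lemma natVal_inj {π : Equiv.Perm (Fin d)} {i j : ℕ} (hi : i < d) (hj : j < d)
    (h : natVal π i = natVal π j) : i = j := by
  simpa [natVal, hi, hj, Fin.val_inj] using h

lemma natVal_lt (π : Equiv.Perm (Fin d)) {i : ℕ} (hi : i < d) : natVal π i < d := by
  simp [natVal, hi]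

lemma isDegenerate_iff {π : Equiv.Perm (Fin d)} : IsDegenerate π ↔ ∃ j, j + 1 < d ∧
    (natVal π (j + 1) = natVal π j + 1 ∨
      (natVal π j = d - 1 ∧ natVal π (j + 1) = 0 ∧ natVal π 0 = natVal π (d - 1) + 1) ∨
      (natVal π (j + 1) = 0 ∧ natVal π 0 = natVal π j + 1) ∨
      (natVal π (j + 1) = natVal π (d - 1) + 1 ∧ natVal π j = d - 1)) := by
  refine exists_congr fun j => ?_
  rw [← exists_prop]
  refine exists_congr fun hj => ?_
  have h1 : j < d := by omega
  have h2 : 0 < d := by omega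
  have h3 : d - 1 < d := by omega
  simp only [natVal, hj, h1, h2, h3, dite_true]

variable [NeZero d]

lemma lastIdx_val : (lastIdx d : ℕ) = d - 1 := rfl

/-- `RauzyPath π₀ N₀ m π N`: there are `m` Rauzy moves leading from `π₀` to `π`, and multiplying
`N₀` by their matrices gives `N`. -/
inductive RauzyPath (π₀ : Equiv.Perm (Fin d)) (N₀ : Matrix (Fin d) (Fin d) ℤ) :
    ℕ → Equiv.Perm (Fin d) → Matrix (Fin d) (Fin d) ℤ → Prop
  | refl : RauzyPath π₀ N₀ 0 π₀ N₀
  | moveA {m : ℕ} {π π' : Equiv.Perm (Fin d)} {N : Matrix (Fin d) (Fin d) ℤ} :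
      RauzyPath π₀ N₀ m π N → π.symm (lastIdx d) ≠ lastIdx d → RauzyMoveA π π' →
      RauzyPath π₀ N₀ (m + 1) π' (N * matA π)
  | moveB {m : ℕ} {π π' : Equiv.Perm (Fin d)} {N : Matrix (Fin d) (Fin d) ℤ} :
      RauzyPath π₀ N₀ m π N → π.symm (lastIdx d) ≠ lastIdx d → RauzyMoveB π π' →
      RauzyPath π₀ N₀ (m + 1) π' (N * matB π)

lemma RauzyPath.trans {π₀ π₁ π₂ : Equiv.Perm (Fin d)} {N₀ N₁ N₂ : Matrix (Fin d) (Fin d) ℤ}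
    {m k : ℕ} (h₁ : RauzyPath π₀ N₀ m π₁ N₁) (h₂ : RauzyPath π₁ N₁ k π₂ N₂) :
    RauzyPath π₀ N₀ (m + k) π₂ N₂ := by
  induction h₂ with
  | refl => exact h₁
  | moveA _ hne hm ih => exact ih.moveA hne hm
  | moveB _ hne hm ih => exact ih.moveB hne hm

lemma RauzyPath.inRauzyClass {π₀ π : Equiv.Perm (Fin d)} {N₀ N : Matrix (Fin d) (Fin d) ℤ}
    {m : ℕ} (h : RauzyPath π₀ N₀ m π N) : InRauzyClass π₀ π := by
  induction h with
  | refl => exact .refl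
  | moveA _ _ hm ih => exact ih.tail (.inl hm)
  | moveB _ _ hm ih => exact ih.tail (.inr hm)

lemma RauzyPath.exists_factor {π₀ π : Equiv.Perm (Fin d)} {N₀ N : Matrix (Fin d) (Fin d) ℤ}
    {m : ℕ} (h : RauzyPath π₀ N₀ m π N) :
    ∃ Γ : Matrix (Fin d) (Fin d) ℤ, RauzyPath π₀ 1 m π Γ ∧ N = N₀ * Γ := by
  induction h with
  | refl => exact ⟨1, .refl, by simp⟩
  | moveA _ hne hm ih =>
    obtain ⟨Γ, hp, rfl⟩ := ih
    exact ⟨_, hp.moveA hne hm, Matrix.mul_assoc _ _ _⟩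
  | moveB _ hne hm ih =>
    obtain ⟨Γ, hp, rfl⟩ := ih
    exact ⟨_, hp.moveB hne hm, Matrix.mul_assoc _ _ _⟩

/-! ### Invariants of Rauzy moves -/

lemma val_symm_add_one_lt {π : Equiv.Perm (Fin d)} (hne : π.symm (lastIdx d) ≠ lastIdx d) :
    (π.symm (lastIdx d) : ℕ) + 1 < d := by
  have h1 := (π.symm (lastIdx d)).isLt
  have h2 : (π.symm (lastIdx d) : ℕ) ≠ d - 1 := fun h => hne (Fin.ext h)
  omega

lemma natVal_pivot (π : Equiv.Perm (Fin d)) :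
    natVal π (π.symm (lastIdx d)) = d - 1 := by
  simp [natVal, lastIdx_val]

lemma natVal_eq_last {π : Equiv.Perm (Fin d)} {i : ℕ} (hi : i < d)
    (h : natVal π i = d - 1) : i = π.symm (lastIdx d) :=
  natVal_inj hi (Fin.isLt _) (h.trans (natVal_pivot π).symm)

lemma RauzyMoveA.isIrreducible {π π' : Equiv.Perm (Fin d)} (hm : RauzyMoveA π π')
    (hi : IsIrreducible π) : IsIrreducible π' := by
  rw [isIrreducible_iff] at hi ⊢
  intro k hk hkd
  obtain ⟨j, hjk, hkj⟩ := hi k hk hkd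
  by_cases hp : (π.symm (lastIdx d) : ℕ) < k
  · refine ⟨π.symm (lastIdx d), hp, ?_⟩
    rw [(hm _).1 le_rfl, Equiv.apply_symm_apply, lastIdx_val]
    omega
  · exact ⟨j, hjk, by rwa [(hm j).1 (by omega)]⟩

lemma RauzyMoveB.isIrreducible {π π' : Equiv.Perm (Fin d)} (hm : RauzyMoveB π π')
    (hi : IsIrreducible π) : IsIrreducible π' := by
  rw [isIrreducible_iff] at hi ⊢
  intro k hk hkd
  obtain ⟨j, hjk, hkj⟩ := hi k hk hkd
  by_contra hcon
  push Not at hcon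
  have hq : k ≤ (π (lastIdx d) : ℕ) := by
    by_contra hlt
    have hmaps : Set.MapsTo π' {j : Fin d | (j : ℕ) < k} {j : Fin d | (j : ℕ) < k} :=
      fun j hj => hcon j hj
    have hsurj := (((Set.toFinite _).injOn_iff_bijOn_of_mapsTo hmaps).1 π'.injective.injOn).surjOn
    have hl : (π' (lastIdx d) : ℕ) < k := by
      rw [(hm (lastIdx d)).1 le_rfl]; omega
    obtain ⟨i, hi, hie⟩ := hsurj hl
    have := π'.injective hie
    subst this
    simp [lastIdx_val] at hi
    omega
  have h1 := hm j
  have h2 := hcon j hjk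
  have h3 := (π j).isLt
  omega

lemma RauzyMoveA.isDegenerate {π π' : Equiv.Perm (Fin d)} (hm : RauzyMoveA π π')
    (hne : π.symm (lastIdx d) ≠ lastIdx d) (hd : IsDegenerate π') : IsDegenerate π := by
  have hp := val_symm_add_one_lt hne
  have hv := natVal_pivot π
  have hinj := fun i (hi : i < d) => natVal_eq_last (π := π) hi
  have hlt := fun i (hi : i < d) => natVal_lt π hi
  rw [isDegenerate_iff] at hd ⊢
  have h1 : ∀ i < d, i ≤ π.symm (lastIdx d) → natVal π' i = natVal π i := fun i hi h => by
    simp [natVal, hi, (hm ⟨i, hi⟩).1 h]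
  have h2 : natVal π' (π.symm (lastIdx d) + 1) = natVal π (d - 1) := by
    have : d - 1 < d := by omega
    simp only [natVal, hp, this, dite_true, (hm ⟨_, hp⟩).2.1 rfl]
    rfl
  have h3 : ∀ i < d, π.symm (lastIdx d) + 1 < i → natVal π' i = natVal π (i - 1) :=
    fun i hi h => by
      have : i - 1 < d := by omega
      simp only [natVal, hi, this, dite_true, (hm ⟨i, hi⟩).2.2 h]
  generalize (π.symm (lastIdx d) : ℕ) = p at *
  generalize natVal π = f at *
  generalize natVal π' = f' at *
  obtain ⟨j, hj, h⟩ := hd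
  by_cases hpd : p = d - 2
  · refine ⟨j, hj, ?_⟩
    have : ∀ i < d, f' i = f i := fun i hi => by
      rcases Nat.lt_or_ge p i with h | h
      · rw [show i = p + 1 by omega, h2, show d - 1 = p + 1 by omega]
      · exact h1 i hi h
    rwa [this _ hj, this j (by omega), this 0 (by omega), this (d - 1) (by omega)] at h
  have h0 := h1 0 (by omega) (by omega)
  have hl := h3 (d - 1) (by omega) (by omega)
  have hpp := h1 p (by omega) le_rfl
  rw [h0, hl] at h
  have hd1 := hlt (d - 1) (by omega)
  have hd2 : d - 2 + 1 = d - 1 := by omega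
  have hd3 : d - 1 - 1 = d - 2 := by omega
  rw [hd3] at h
  rcases lt_trichotomy j p with hjp | rfl | hjp
  · refine ⟨j, hj, ?_⟩
    rw [h1 _ hj (by omega), h1 j (by omega) (by omega)] at h
    have := hinj j (by omega)
    omega
  · rw [h2, hpp, hv] at h
    have := hlt 0 (by omega)
    refine ⟨d - 2, by omega, ?_⟩
    rw [hd2]
    omega
  · have e : f' (j + 1) = f j := by simpa using h3 (j + 1) hj (by omega)
    rw [e] at h
    rcases Nat.lt_or_ge (p + 1) j with hj' | hj'
    · rw [h3 j (by omega) hj'] at h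
      refine ⟨j - 1, by omega, ?_⟩
      rw [show j - 1 + 1 = j by omega]
      have := hinj (j - 1) (by omega)
      omega
    · obtain rfl : j = p + 1 := by omega
      rw [h2] at h
      have := hinj (d - 1) (by omega)
      refine ⟨p, by omega, ?_⟩
      omega

lemma RauzyMoveB.isDegenerate {π π' : Equiv.Perm (Fin d)} (hm : RauzyMoveB π π')
    (hd : IsDegenerate π') : IsDegenerate π := by
  have hinj := fun i (hi : i < d) j (hj : j < d) => natVal_inj (π := π) hi hj
  have hlt := fun i (hi : i < d) => natVal_lt π hi
  have hm' : ∀ i < d, (natVal π i ≤ natVal π (d - 1) → natVal π' i = natVal π i) ∧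
      (natVal π (d - 1) < natVal π i → natVal π i < d - 1 → natVal π' i = natVal π i + 1) ∧
      (natVal π i = d - 1 → natVal π' i = natVal π (d - 1) + 1) := fun i hi => by
    have hd1 : d - 1 < d := by omega
    obtain ⟨h1, h2, h3⟩ := hm ⟨i, hi⟩
    simp only [natVal, hi, hd1, dite_true]
    exact ⟨fun h => congrArg Fin.val (h1 h), h2, h3⟩
  rw [isDegenerate_iff] at hd ⊢
  generalize natVal π = f at *
  generalize natVal π' = f' at *
  obtain ⟨j, hj, h⟩ := hd
  refine ⟨j, hj, ?_⟩
  have hl := (hm' (d - 1) (by omega)).1 le_rfl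
  have hlt0 := hlt j (by omega)
  have hlt1 := hlt (j + 1) hj
  have hlt2 := hlt 0 (by omega)
  have hlt3 := hlt (d - 1) (by omega)
  have hi0 := hinj j (by omega) (d - 1) (by omega)
  have hi1 := hinj (j + 1) hj (d - 1) (by omega)
  have hi2 := hinj (j + 1) hj j (by omega)
  have hi3 := hinj 0 (by omega) j (by omega)
  have hi4 := hinj 0 (by omega) (d - 1) (by omega)
  have hcases : ∀ i < d, f' i = f i ∧ f i ≤ f (d - 1) ∨
      f' i = f i + 1 ∧ f (d - 1) < f i ∧ f i < d - 1 ∨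
      f' i = f (d - 1) + 1 ∧ f i = d - 1 := fun i hi => by
    have h1 := hm' i hi
    have h2 := hlt i hi
    omega
  have hc0 := hcases j (by omega)
  have hc1 := hcases (j + 1) hj
  have hc2 := hcases 0 (by omega)
  clear hcases hm' hlt hinj
  rcases h with h | h | h | h
  · clear hc2 hi3 hi4
    rcases hc0 with h1 | h1 | h1 <;> rcases hc1 with h2 | h2 | h2 <;> omega
  · rcases hc0 with h1 | h1 | h1 <;> rcases hc1 with h2 | h2 | h2 <;>
      rcases hc2 with h3 | h3 | h3 <;> omega
  · rcases hc0 with h1 | h1 | h1 <;> rcases hc1 with h2 | h2 | h2 <;>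
      rcases hc2 with h3 | h3 | h3 <;> omega
  · clear hc2 hi3 hi4
    rcases hc0 with h1 | h1 | h1 <;> rcases hc1 with h2 | h2 | h2 <;> omega

lemma RauzyPath.isIrreducible {π₀ π : Equiv.Perm (Fin d)} {N₀ N : Matrix (Fin d) (Fin d) ℤ}
    {m : ℕ} (h : RauzyPath π₀ N₀ m π N) (hi : IsIrreducible π₀) : IsIrreducible π := by
  induction h with
  | refl => exact hi
  | moveA _ _ hm ih => exact hm.isIrreducible ih
  | moveB _ _ hm ih => exact hm.isIrreducible ih

lemma RauzyPath.not_isDegenerate {π₀ π : Equiv.Perm (Fin d)}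
    {N₀ N : Matrix (Fin d) (Fin d) ℤ} {m : ℕ} (h : RauzyPath π₀ N₀ m π N)
    (hi : ¬ IsDegenerate π₀) : ¬ IsDegenerate π := by
  induction h with
  | refl => exact hi
  | moveA _ hne hm ih => exact fun hd => ih (hm.isDegenerate hne hd)
  | moveB _ _ hm ih => exact fun hd => ih (hm.isDegenerate hd)

/-! ### The matrices of Rauzy moves -/

lemma matA_mulVec_of_lt (π : Equiv.Perm (Fin d)) (v : Fin d → ℝ) {i : Fin d}
    (hi : (i : ℕ) < (π.symm (lastIdx d) : ℕ)) :
    ((matA π).map (Int.cast : ℤ → ℝ)).mulVec v i = v i := by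
  have hp := (π.symm (lastIdx d)).isLt
  have : ∀ j, matA π i j = if j = i then 1 else 0 := fun j => by
    simp only [matA, Matrix.of_apply, Fin.ext_iff, lastIdx_val]
    split_ifs <;> first | rfl | omega
  simp [Matrix.mulVec, dotProduct, this]

lemma matA_mulVec_pivot (π : Equiv.Perm (Fin d)) (v : Fin d → ℝ)
    (hp : (π.symm (lastIdx d) : ℕ) + 1 < d) :
    ((matA π).map (Int.cast : ℤ → ℝ)).mulVec v (π.symm (lastIdx d)) =
      v (π.symm (lastIdx d)) + v ⟨_, hp⟩ := by
  have : ∀ j, matA π (π.symm (lastIdx d)) j =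
      (if j = π.symm (lastIdx d) then 1 else 0) +
        if j = ⟨(π.symm (lastIdx d) : ℕ) + 1, hp⟩ then 1 else 0 := fun j => by
    simp only [matA, Matrix.of_apply, Fin.ext_iff, lastIdx_val]
    split_ifs <;> first | rfl | omega
  simp [Matrix.mulVec, dotProduct, this, add_mul, Finset.sum_add_distrib]

lemma matA_mulVec_of_gt (π : Equiv.Perm (Fin d)) (v : Fin d → ℝ) {i : Fin d}
    (hi : (π.symm (lastIdx d) : ℕ) < (i : ℕ)) (hid : (i : ℕ) + 1 < d) :
    ((matA π).map (Int.cast : ℤ → ℝ)).mulVec v i = v ⟨i + 1, hid⟩ := by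
  have : ∀ j, matA π i j = if j = ⟨i + 1, hid⟩ then 1 else 0 := fun j => by
    simp only [matA, Matrix.of_apply, Fin.ext_iff, lastIdx_val]
    split_ifs <;> first | rfl | omega
  simp [Matrix.mulVec, dotProduct, this]

lemma matA_mulVec_last (π : Equiv.Perm (Fin d)) (v : Fin d → ℝ)
    (hp : (π.symm (lastIdx d) : ℕ) + 1 < d) :
    ((matA π).map (Int.cast : ℤ → ℝ)).mulVec v (lastIdx d) = v ⟨_, hp⟩ := by
  have : ∀ j, matA π (lastIdx d) j =
      if j = ⟨(π.symm (lastIdx d) : ℕ) + 1, hp⟩ then 1 else 0 := fun j => by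
    simp only [matA, Matrix.of_apply, Fin.ext_iff, lastIdx_val]
    split_ifs <;> first | rfl | omega
  simp [Matrix.mulVec, dotProduct, this]

lemma matB_mulVec (π : Equiv.Perm (Fin d)) (v : Fin d → ℝ)
    (hne : π.symm (lastIdx d) ≠ lastIdx d) (i : Fin d) :
    ((matB π).map (Int.cast : ℤ → ℝ)).mulVec v i =
      v i + if i = lastIdx d then v (π.symm (lastIdx d)) else 0 := by
  have : ∀ j, matB π i j = (if j = i then 1 else 0) +
      if j = π.symm (lastIdx d) then (if i = lastIdx d then 1 else 0) else 0 := fun j => by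
    simp only [matB, Matrix.of_apply]
    grind
  simp [Matrix.mulVec, dotProduct, this, add_mul, Finset.sum_add_distrib]

lemma lenAfterA_mulVec (π : Equiv.Perm (Fin d)) (v : Fin d → ℝ)
    (hne : π.symm (lastIdx d) ≠ lastIdx d) :
    lenAfterA π (((matA π).map (Int.cast : ℤ → ℝ)).mulVec v) = v := by
  have hp := val_symm_add_one_lt hne
  funext j
  unfold lenAfterA
  split_ifs with h1 h2 h3
  · exact matA_mulVec_of_lt π v h1
  · obtain rfl : j = π.symm (lastIdx d) := Fin.ext h2
    rw [matA_mulVec_pivot π v hp, matA_mulVec_last π v hp]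
    ring
  · rw [matA_mulVec_last π v hp]
    exact congrArg v (Fin.ext h3.symm)
  · rw [matA_mulVec_of_gt π v (by simp only; omega) (by simp only; omega)]
    exact congrArg v (Fin.ext (by simp only; omega))

lemma lenAfterB_mulVec (π : Equiv.Perm (Fin d)) (v : Fin d → ℝ)
    (hne : π.symm (lastIdx d) ≠ lastIdx d) :
    lenAfterB π (((matB π).map (Int.cast : ℤ → ℝ)).mulVec v) = v := by
  funext j
  unfold lenAfterB
  split_ifs with h1 <;> simp [matB_mulVec π v hne, h1, hne]

lemma matA_mulVec_pos (π : Equiv.Perm (Fin d)) (v : Fin d → ℝ)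
    (hne : π.symm (lastIdx d) ≠ lastIdx d) (hv : ∀ i, 0 < v i) (i : Fin d) :
    0 < ((matA π).map (Int.cast : ℤ → ℝ)).mulVec v i := by
  have hp := val_symm_add_one_lt hne
  rcases lt_trichotomy (i : ℕ) (π.symm (lastIdx d) : ℕ) with h | h | h
  · rw [matA_mulVec_of_lt π v h]; exact hv _
  · obtain rfl : i = π.symm (lastIdx d) := Fin.ext h
    rw [matA_mulVec_pivot π v hp]; exact add_pos (hv _) (hv _)
  · by_cases hi : (i : ℕ) + 1 < d
    · rw [matA_mulVec_of_gt π v h hi]; exact hv _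
    · obtain rfl : i = lastIdx d := Fin.ext (by rw [lastIdx_val]; omega)
      rw [matA_mulVec_last π v hp]; exact hv _

lemma matB_mulVec_pos (π : Equiv.Perm (Fin d)) (v : Fin d → ℝ)
    (hne : π.symm (lastIdx d) ≠ lastIdx d) (hv : ∀ i, 0 < v i) (i : Fin d) :
    0 < ((matB π).map (Int.cast : ℤ → ℝ)).mulVec v i := by
  rw [matB_mulVec π v hne]
  have h1 := hv i
  have h2 := hv (π.symm (lastIdx d))
  split_ifs <;> linarith

lemma RauzyPath.mulVec_pos {π₀ π : Equiv.Perm (Fin d)} {N : Matrix (Fin d) (Fin d) ℤ}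
    {m : ℕ} (h : RauzyPath π₀ 1 m π N) (v : Fin d → ℝ) (hv : ∀ i, 0 < v i) (i : Fin d) :
    0 < (N.map (Int.cast : ℤ → ℝ)).mulVec v i := by
  induction h generalizing v i with
  | refl => simpa using hv i
  | moveA _ hne _ ih => rw [map_mul_mulVec]; exact ih _ (matA_mulVec_pos _ v hne hv) i
  | moveB _ hne _ ih => rw [map_mul_mulVec]; exact ih _ (matB_mulVec_pos _ v hne hv) i

lemma RauzyPath.mulVec_injective {π₀ π : Equiv.Perm (Fin d)} {N : Matrix (Fin d) (Fin d) ℤ}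
    {m : ℕ} (h : RauzyPath π₀ 1 m π N) :
    Function.Injective (N.map (Int.cast : ℤ → ℝ)).mulVec := by
  induction h with
  | refl => exact fun v w h => by simpa using h
  | moveA _ hne _ ih =>
    intro v w hvw
    rw [map_mul_mulVec, map_mul_mulVec] at hvw
    exact (Function.LeftInverse.injective (lenAfterA_mulVec _ · hne)) (ih hvw)
  | moveB _ hne _ ih =>
    intro v w hvw
    rw [map_mul_mulVec, map_mul_mulVec] at hvw
    exact (Function.LeftInverse.injective (lenAfterB_mulVec _ · hne)) (ih hvw)

/-! ### Paths and chains -/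

lemma chainMatrix_succ {n : ℕ} (c : RauzyChain d n) (m : ℕ) :
    chainMatrix c (m + 1) = chainMatrix c m * stepMat (c.seq m) := by
  simp [chainMatrix, chainMatrixFrom, List.range_succ]

lemma RauzyChain.rauzyPath {n : ℕ} (c : RauzyChain d n) {m : ℕ} (hm : m ≤ n) :
    RauzyPath (c.seq 0).perm 1 m (c.seq m).perm (chainMatrix c m) := by
  induction m with
  | zero => simpa [chainMatrix, chainMatrixFrom] using RauzyPath.refl
  | succ m ih =>
    rw [chainMatrix_succ]
    rcases c.step m hm with ⟨hs, hmv, -⟩ | ⟨hs, hmv, -⟩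
    · rw [stepMat, if_pos hs]
      refine (ih (by omega)).moveA (fun he => ?_) hmv
      rw [stepA, he] at hs
      exact lt_irrefl _ hs
    · rw [stepMat, if_neg (show ¬ stepA _ from not_lt_of_gt hs)]
      refine (ih (by omega)).moveB (fun he => ?_) hmv
      rw [stepB, he] at hs
      exact lt_irrefl _ hs

/-- A chain extended by one step. -/
lemma exists_chain_snoc {m : ℕ} (c : RauzyChain d m) (T : IET d)
    (hT : IsRauzyStep (c.seq m) T) :
    ∃ c' : RauzyChain d (m + 1), c'.seq 0 = c.seq 0 ∧ c'.seq (m + 1) = T ∧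
      chainMatrix c' (m + 1) = chainMatrix c m * stepMat (c.seq m) := by
  have hstep : ∀ i, i < m + 1 → IsRauzyStep (if i ≤ m then c.seq i else T)
      (if i + 1 ≤ m then c.seq (i + 1) else T) := fun i hi => by
    rcases (Nat.lt_succ_iff.1 hi).lt_or_eq with h | rfl
    · simpa [h.le, Nat.succ_le_of_lt h] using c.step i h
    · simpa using hT
  refine ⟨⟨fun i => if i ≤ m then c.seq i else T, hstep⟩, by simp, by simp, ?_⟩
  rw [chainMatrix_succ]
  simp only [le_refl, if_true]
  congr 1
  simp only [chainMatrix, chainMatrixFrom, zero_add]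
  congr 1
  refine List.map_congr_left fun i hi => ?_
  rw [if_pos (List.mem_range.1 hi).le]

lemma RauzyPath.exists_chain {π₀ π : Equiv.Perm (Fin d)} {N : Matrix (Fin d) (Fin d) ℤ}
    {m : ℕ} (h : RauzyPath π₀ 1 m π N) (v : Fin d → ℝ) (hv : ∀ i, 0 < v i) :
    ∃ c : RauzyChain d m, c.seq 0 = ⟨π₀, (N.map (Int.cast : ℤ → ℝ)).mulVec v⟩ ∧
      c.seq m = ⟨π, v⟩ ∧ chainMatrix c m = N := by
  induction h generalizing v with
  | refl =>
    exact ⟨⟨fun _ => ⟨π₀, v⟩, fun i hi => absurd hi (Nat.not_lt_zero i)⟩, by simp, rfl,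
      by simp [chainMatrix, chainMatrixFrom]⟩
  | @moveA m π π' N _ hne hm ih =>
    obtain ⟨c, h0, hl, hM⟩ := ih _ (matA_mulVec_pos π v hne hv)
    have hs : stepA (c.seq m) := by
      have hp := val_symm_add_one_lt hne
      rw [hl]
      simp only [stepA]
      rw [matA_mulVec_pivot π v hp, matA_mulVec_last π v hp]
      linarith [hv (π.symm (lastIdx d))]
    obtain ⟨c', h0', hl', hM'⟩ := exists_chain_snoc c ⟨π', v⟩
      (.inl ⟨hs, by rw [hl]; exact hm, by rw [hl]; exact (lenAfterA_mulVec π v hne).symm⟩)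
    refine ⟨c', by rw [h0', h0, map_mul_mulVec], hl', ?_⟩
    rw [hM', hM, stepMat, if_pos hs, hl]
  | @moveB m π π' N _ hne hm ih =>
    obtain ⟨c, h0, hl, hM⟩ := ih _ (matB_mulVec_pos π v hne hv)
    have hs : stepB (c.seq m) := by
      rw [hl]
      simp only [stepB]
      rw [matB_mulVec π v hne, matB_mulVec π v hne, if_neg hne, if_pos rfl]
      linarith [hv (lastIdx d)]
    obtain ⟨c', h0', hl', hM'⟩ := exists_chain_snoc c ⟨π', v⟩
      (.inr ⟨hs, by rw [hl]; exact hm, by rw [hl]; exact (lenAfterB_mulVec π v hne).symm⟩)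
    refine ⟨c', by rw [h0', h0, map_mul_mulVec], hl', ?_⟩
    rw [hM', hM, stepMat, if_neg (show ¬ stepA _ from not_lt_of_gt hs), hl]

end Paths

section Labelling

variable {d : ℕ} {α : Type*}

/-- The permutation `π` matches the positions of the letters in the two rows of the state `s`, and
the weights of `s` are the column sums of `N`. -/
structure Represents (s : List α × List α × (α → ℤ)) (π : Equiv.Perm (Fin d))
    (N : Matrix (Fin d) (Fin d) ℤ) : Prop where
  nodup : s.1.Nodup
  perm : s.1.Perm s.2.1
  length_eq : s.1.length = d
  bot_getElem? : ∀ j : Fin d, s.2.1[(π j : ℕ)]? = s.1[(j : ℕ)]?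
  colSum_eq : ∀ (j : Fin d) (x : α), s.1[(j : ℕ)]? = some x → colSum N j = s.2.2 x

lemma Represents.apply_eq {s : List α × List α × (α → ℤ)} {π : Equiv.Perm (Fin d)}
    {N : Matrix (Fin d) (Fin d) ℤ} (hs : Represents s π N) {i j : Fin d} {x : α}
    (hi : s.1[(i : ℕ)]? = some x) (hj : s.2.1[(j : ℕ)]? = some x) : π i = j := by
  have hb := hs.perm.nodup_iff.1 hs.nodup
  have hl : s.2.1.length = d := hs.perm.length_eq.symm.trans hs.length_eq
  exact Fin.ext ((List.getElem?_inj (by rw [hl]; exact (π i).isLt) hb).1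
    ((hs.bot_getElem? i).trans (hi.trans hj.symm)))

lemma getElem?_append_cons_of_le (t : List α) (A : α) (u v : List α) {j : ℕ} (hj : j ≤ t.length) :
    (t ++ A :: u)[j]? = (t ++ A :: v)[j]? := by
  rcases hj.lt_or_eq with h | rfl
  · rw [List.getElem?_append_left h, List.getElem?_append_left h]
  · simp

lemma getElem?_append_cons_concat (t : List α) (A : α) (u : List α) (Z : α) :
    (t ++ A :: (u ++ [Z]))[t.length + u.length + 1]? = some Z := by
  rw [List.getElem?_append_right (by omega),
    show t.length + u.length + 1 - t.length = u.length + 1 by omega]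
  simp

lemma getElem?_append_cons_succ (t : List α) (A : α) (u : List α) (Z : α) {j : ℕ}
    (hj : t.length < j) (hju : j ≤ t.length + u.length) :
    (t ++ A :: Z :: u)[j + 1]? = (t ++ A :: (u ++ [Z]))[j]? := by
  obtain ⟨k, rfl⟩ : ∃ k, j = t.length + (k + 1) := ⟨j - t.length - 1, by omega⟩
  rw [List.getElem?_append_right (by omega), List.getElem?_append_right (by omega),
    show t.length + (k + 1) + 1 - t.length = k + 2 by omega,
    show t.length + (k + 1) - t.length = k + 1 by omega]
  simp [List.getElem?_append_left (show k < u.length by omega)]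

lemma exists_perm_getElem? {t b : List α} (ht : t.Nodup) (hp : t.Perm b) (hl : t.length = d) :
    ∃ π : Equiv.Perm (Fin d), ∀ j : Fin d, b[(π j : ℕ)]? = t[(j : ℕ)]? := by
  classical
  subst hl
  have hmem : ∀ j : Fin t.length, t[j] ∈ b := fun j => hp.mem_iff.1 (List.getElem_mem _)
  have hlt : ∀ j : Fin t.length, b.idxOf t[j] < t.length := fun j =>
    (List.idxOf_lt_length_iff.2 (hmem j)).trans_eq hp.length_eq.symm
  have hget : ∀ j : Fin t.length, b[b.idxOf t[j]]? = t[(j : ℕ)]? := fun j => by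
    rw [List.getElem?_eq_getElem (hp.length_eq ▸ hlt j), List.getElem_idxOf]
    simp
  have hinj : Function.Injective fun j : Fin t.length => (⟨b.idxOf t[j], hlt j⟩ : Fin t.length) := by
    intro i j hij
    have h1 := (hget i).symm.trans ((congrArg (fun k : Fin t.length => b[(k : ℕ)]?) hij).trans
      (hget j))
    exact Fin.ext ((List.getElem?_inj i.isLt ht).1 h1)
  exact ⟨Equiv.ofBijective _ (Finite.injective_iff_bijective.1 hinj), hget⟩

lemma colSum_mul (M N : Matrix (Fin d) (Fin d) ℤ) (j : Fin d) :
    colSum (M * N) j = ∑ k, colSum M k * N k j := by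
  simp only [colSum, Matrix.mul_apply, Finset.sum_mul]
  exact Finset.sum_comm

variable [NeZero d]

lemma colSum_mul_matA_of_le (π : Equiv.Perm (Fin d)) (N : Matrix (Fin d) (Fin d) ℤ) {j : Fin d}
    (hj : (j : ℕ) ≤ π.symm (lastIdx d)) : colSum (N * matA π) j = colSum N j := by
  have : ∀ k, matA π k j = if k = j then 1 else 0 := fun k => by
    simp only [matA, Matrix.of_apply, if_pos hj]
  simp [colSum_mul, this]

lemma colSum_mul_matA_pivot (π : Equiv.Perm (Fin d)) (N : Matrix (Fin d) (Fin d) ℤ) {j : Fin d}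
    (hj : (j : ℕ) = π.symm (lastIdx d) + 1) :
    colSum (N * matA π) j = colSum N (lastIdx d) + colSum N (π.symm (lastIdx d)) := by
  have : ∀ k, matA π k j = (if k = lastIdx d then 1 else 0) +
      if k = π.symm (lastIdx d) then 1 else 0 := fun k => by
    have := j.isLt
    simp only [matA, Matrix.of_apply, Fin.ext_iff, lastIdx_val]
    split_ifs <;> first | rfl | omega
  simp [colSum_mul, this, mul_add, Finset.sum_add_distrib]

lemma colSum_mul_matA_of_gt (π : Equiv.Perm (Fin d)) (N : Matrix (Fin d) (Fin d) ℤ) {i j : Fin d}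
    (hi : (π.symm (lastIdx d) : ℕ) < i) (hj : (j : ℕ) = i + 1) :
    colSum (N * matA π) j = colSum N i := by
  have : ∀ k, matA π k j = if k = i then 1 else 0 := fun k => by
    have := j.isLt
    simp only [matA, Matrix.of_apply, Fin.ext_iff, lastIdx_val]
    split_ifs <;> first | rfl | omega
  simp [colSum_mul, this]

lemma colSum_mul_matB (π : Equiv.Perm (Fin d)) (N : Matrix (Fin d) (Fin d) ℤ)
    (hne : π.symm (lastIdx d) ≠ lastIdx d) (j : Fin d) :
    colSum (N * matB π) j =
      colSum N j + if j = π.symm (lastIdx d) then colSum N (lastIdx d) else 0 := by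
  have : ∀ k, matB π k j = (if k = j then 1 else 0) +
      if k = lastIdx d then (if j = π.symm (lastIdx d) then 1 else 0) else 0 := fun k => by
    simp only [matB, Matrix.of_apply]
    grind
  simp [colSum_mul, this, mul_add, Finset.sum_add_distrib]

lemma RauzyPath.colSum_pos {π₀ π : Equiv.Perm (Fin d)} {N : Matrix (Fin d) (Fin d) ℤ} {m : ℕ}
    (h : RauzyPath π₀ 1 m π N) (j : Fin d) : 0 < colSum N j := by
  induction h generalizing j with
  | refl => simp [colSum, Matrix.one_apply]
  | @moveA _ π _ N _ hne _ ih =>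
    rcases lt_trichotomy (j : ℕ) (π.symm (lastIdx d) + 1) with hj | hj | hj
    · rw [colSum_mul_matA_of_le π N (by omega)]; exact ih j
    · rw [colSum_mul_matA_pivot π N hj]; exact add_pos (ih _) (ih _)
    · rw [colSum_mul_matA_of_gt π N (i := ⟨j - 1, by omega⟩) (by simp only; omega)
        (by simp only; omega)]
      exact ih _
  | @moveB _ π _ N _ hne _ ih =>
    rw [colSum_mul_matB π N hne]
    have h1 := ih j
    have h2 := ih (lastIdx d)
    split_ifs <;> omega

lemma RauzyPath.primitive_colSum {π₀ π : Equiv.Perm (Fin d)} {N : Matrix (Fin d) (Fin d) ℤ}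
    {m : ℕ} (h : RauzyPath π₀ 1 m π N) : Primitive (colSum N) := by
  induction h with
  | refl =>
    intro g hg
    have := hg (lastIdx d)
    simpa [colSum, Matrix.one_apply, isUnit_iff_dvd_one] using this
  | @moveA _ π _ N _ hne _ ih =>
    refine fun g hg => ih g fun i => ?_
    have hp := val_symm_add_one_lt hne
    have hlow : ∀ i : Fin d, (i : ℕ) ≤ π.symm (lastIdx d) → g ∣ colSum N i := fun i hi =>
      colSum_mul_matA_of_le π N hi ▸ hg i
    rcases Nat.lt_or_ge (π.symm (lastIdx d) : ℕ) i with hi | hi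
    · by_cases hid : (i : ℕ) + 1 < d
      · exact colSum_mul_matA_of_gt π N (j := ⟨i + 1, hid⟩) hi rfl ▸ hg _
      · obtain rfl : i = lastIdx d := Fin.ext (by rw [lastIdx_val]; omega)
        have := hg ⟨_, hp⟩
        rw [colSum_mul_matA_pivot π N rfl] at this
        exact (dvd_add_left (hlow _ le_rfl)).1 this
    · exact hlow i hi
  | @moveB _ π _ N _ hne _ ih =>
    refine fun g hg => ih g fun i => ?_
    have hlast : g ∣ colSum N (lastIdx d) := by
      simpa [colSum_mul_matB π N hne, hne.symm] using hg (lastIdx d)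
    have := hg i
    rw [colSum_mul_matB π N hne] at this
    split_ifs at this
    · exact (dvd_add_left hlast).1 this
    · simpa using this

variable [DecidableEq α]

/-- A labelled step realises a Rauzy move. -/
lemma WordStep.exists_rauzyPath {s s' : List α × List α × (α → ℤ)} (hw : WordStep s s')
    {π : Equiv.Perm (Fin d)} {N : Matrix (Fin d) (Fin d) ℤ} (hs : Represents s π N) :
    ∃ π' N', RauzyPath π N 1 π' N' ∧ Represents s' π' N' := by
  obtain ⟨π', hπ'⟩ := exists_perm_getElem? (hw.perm.1.nodup_iff.1 hs.nodup)
    (hw.perm.1.symm.trans (hs.perm.trans hw.perm.2))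
    (hw.perm.1.length_eq.symm.trans hs.length_eq)
  have hn' := hw.perm.1.nodup_iff.1 hs.nodup
  have hp' := hw.perm.1.symm.trans (hs.perm.trans hw.perm.2)
  have hl' := hw.perm.1.length_eq.symm.trans hs.length_eq
  have hb := hs.perm.nodup_iff.1 hs.nodup
  have hlb := hs.perm.length_eq.symm.trans hs.length_eq
  have hb' := hp'.nodup_iff.1 hn'
  have hlb' := hp'.length_eq.symm.trans hl'
  cases hw with
  | top t A u Z b h =>
    have hn := hs.nodup
    have hl := hs.length_eq
    simp only at hn hl hn' hp' hl' hb hlb hb' hlb' hπ'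
    have hd : t.length + u.length + 2 = d := by simp at hl; omega
    have hdb : b.length + 1 = d := by simpa using hlb
    have hp : π.symm (lastIdx d) = ⟨t.length, by omega⟩ := by
      rw [Equiv.symm_apply_eq]
      refine (hs.apply_eq (x := A) (by simp) ?_).symm
      have : (lastIdx d : ℕ) = b.length := by rw [lastIdx_val]; omega
      simp [this]
    have hpv : (π.symm (lastIdx d) : ℕ) = t.length := congrArg Fin.val hp
    have hne : π.symm (lastIdx d) ≠ lastIdx d := fun he => by
      have := congrArg Fin.val he
      rw [hpv, lastIdx_val] at this
      omega
    have key : ∀ i j : Fin d, (t ++ A :: Z :: u)[(i : ℕ)]? = (t ++ A :: (u ++ [Z]))[(j : ℕ)]? →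
        π' i = π j := fun i j hij => by
      refine Fin.ext ((List.getElem?_inj (by rw [hlb]; exact (π' i).isLt) hb).1 ?_)
      rw [hπ', hij]
      exact (hs.bot_getElem? j).symm
    have e1 : ∀ j : ℕ, j ≤ t.length → (t ++ A :: Z :: u)[j]? = (t ++ A :: (u ++ [Z]))[j]? :=
      fun j hj => getElem?_append_cons_of_le _ _ _ _ hj
    have e2 : (t ++ A :: Z :: u)[t.length + 1]? = (t ++ A :: (u ++ [Z]))[(lastIdx d : ℕ)]? := by
      rw [show (lastIdx d : ℕ) = t.length + u.length + 1 by rw [lastIdx_val]; omega,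
        getElem?_append_cons_concat]
      simp
    have e3 : ∀ j : ℕ, t.length + 1 < j → j < d →
        (t ++ A :: Z :: u)[j]? = (t ++ A :: (u ++ [Z]))[j - 1]? := by
      intro j hj hjd
      obtain ⟨k, rfl⟩ : ∃ k, j = k + 1 := ⟨j - 1, by omega⟩
      exact getElem?_append_cons_succ _ _ _ _ (by omega) (by omega)
    refine ⟨π', N * matA π, RauzyPath.refl.moveA hne fun j => ⟨fun hj => ?_, fun hj => ?_,
      fun hj => ?_⟩, hn', hp', hl', hπ', fun j x hx => ?_⟩
    · exact key _ _ (e1 _ (hpv ▸ hj))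
    · exact key _ _ (by rw [hj, hpv]; exact e2)
    · exact key _ _ (e3 _ (hpv ▸ hj) j.isLt)
    · have hZ : (t ++ A :: Z :: u)[t.length + 1]? = some Z := by simp
      have hxZ : (j : ℕ) ≠ t.length + 1 → x ≠ Z := fun hj he => by
        subst he
        exact hj ((List.getElem?_inj (by rw [hl']; exact j.isLt) hn').1 (hx.trans hZ.symm))
      simp only at hx ⊢
      rcases lt_trichotomy (j : ℕ) (t.length + 1) with hj | hj | hj
      · rw [colSum_mul_matA_of_le π N (by omega), Function.update_of_ne (hxZ (by omega))]
        exact hs.colSum_eq j x ((e1 j (by omega)).symm.trans hx)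
      · rw [hj] at hx
        obtain rfl : Z = x := Option.some.inj (hZ.symm.trans hx)
        rw [colSum_mul_matA_pivot π N (by omega), Function.update_self, hp,
          hs.colSum_eq (lastIdx d) Z (e2.symm.trans hZ), hs.colSum_eq _ A (by simp)]
      · rw [colSum_mul_matA_of_gt π N (i := ⟨j - 1, by omega⟩) (by simp only; omega)
          (by simp only; omega), Function.update_of_ne (hxZ (by omega))]
        exact hs.colSum_eq _ x ((e3 j hj j.isLt).symm.trans hx)
  | bot t Z b u A h =>
    have hn := hs.nodup
    have hl := hs.length_eq
    simp only at hn hl hn' hp' hl' hb hlb hb' hlb' hπ'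
    have hd : b.length + u.length + 2 = d := by simp at hlb; omega
    have hdt : t.length + 1 = d := by simpa using hl
    have htZ : (t ++ [Z])[(lastIdx d : ℕ)]? = some Z := by
      have : (lastIdx d : ℕ) = t.length := by rw [lastIdx_val]; omega
      simp [this]
    have hq : (π (lastIdx d) : ℕ) = b.length :=
      congrArg Fin.val (hs.apply_eq (j := ⟨b.length, by omega⟩) htZ (by simp))
    have hA : (b ++ Z :: (u ++ [A]))[d - 1]? = some A := by
      rw [show d - 1 = b.length + u.length + 1 by omega, getElem?_append_cons_concat]
    have hpA : (t ++ [Z])[(π.symm (lastIdx d) : ℕ)]? = some A := by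
      have := hs.bot_getElem? (π.symm (lastIdx d))
      rw [Equiv.apply_symm_apply] at this
      exact this.symm.trans hA
    have hne : π.symm (lastIdx d) ≠ lastIdx d := fun he => by
      rw [Equiv.symm_apply_eq] at he
      have := congrArg Fin.val he
      rw [hq, lastIdx_val] at this
      omega
    have key : ∀ (j : Fin d) (i : ℕ),
        (b ++ Z :: A :: u)[i]? = (b ++ Z :: (u ++ [A]))[(π j : ℕ)]? → (π' j : ℕ) = i :=
      fun j i hij => by
        refine (List.getElem?_inj (by rw [hlb']; exact (π' j).isLt) hb').1 ?_
        rw [hπ', hij]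
        exact (hs.bot_getElem? j).symm
    refine ⟨π', N * matB π, RauzyPath.refl.moveB hne fun j => ⟨fun hj => ?_, fun hj hj' => ?_,
      fun hj => ?_⟩, hn', hp', hl', hπ', fun j x hx => ?_⟩
    · exact Fin.ext (key _ _ (getElem?_append_cons_of_le _ _ _ _ (hq ▸ hj)))
    · exact key _ _ (getElem?_append_cons_succ _ _ _ _ (hq ▸ hj) (by omega))
    · refine key _ _ ?_
      rw [hj, hq, hA]
      simp
    · simp only at hx ⊢
      rw [colSum_mul_matB π N hne, hs.colSum_eq j x hx]
      split_ifs with hj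
      · obtain rfl : A = x := Option.some.inj (hpA.symm.trans (hj ▸ hx))
        rw [Function.update_self, hs.colSum_eq _ Z htZ]
      · rw [Function.update_of_ne, add_zero]
        rintro rfl
        exact hj (Fin.ext ((List.getElem?_inj (by rw [hl]; exact j.isLt) hn).1 (hx.trans hpA.symm)))

lemma WordPath.exists_rauzyPath {s s' : List α × List α × (α → ℤ)} (hw : WordPath s s')
    {π : Equiv.Perm (Fin d)} {N : Matrix (Fin d) (Fin d) ℤ} (hs : Represents s π N) :
    ∃ m π' N', RauzyPath π N m π' N' ∧ Represents s' π' N' := by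
  induction hw with
  | refl => exact ⟨0, π, N, .refl, hs⟩
  | tail _ hst ih =>
    obtain ⟨m, π₁, N₁, hp, hr⟩ := ih
    obtain ⟨π₂, N₂, hp', hr'⟩ := hst.exists_rauzyPath hr
    exact ⟨m + 1, π₂, N₂, hp.trans hp', hr'⟩

lemma exists_rauzyPath_of_transGen {s s' : List α × List α × (α → ℤ)}
    (hw : Relation.TransGen WordStep s s') {π : Equiv.Perm (Fin d)}
    {N : Matrix (Fin d) (Fin d) ℤ} (hs : Represents s π N) :
    ∃ m π' N', 0 < m ∧ RauzyPath π N m π' N' ∧ Represents s' π' N' := by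
  obtain ⟨s₁, h₁, hst⟩ := Relation.TransGen.tail'_iff.1 hw
  obtain ⟨m, π₁, N₁, hp, hr⟩ := WordPath.exists_rauzyPath h₁ hs
  obtain ⟨π₂, N₂, hp', hr'⟩ := hst.exists_rauzyPath hr
  exact ⟨m + 1, π₂, N₂, Nat.succ_pos m, hp.trans hp', hr'⟩

end Labelling

section Proxies

variable {d : ℕ}

lemma represents_finRange (π : Equiv.Perm (Fin d)) (N : Matrix (Fin d) (Fin d) ℤ) :
    Represents (List.finRange d, (List.finRange d).map π.symm, colSum N) π N where
  nodup := List.nodup_finRange d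
  perm := (List.perm_ext_iff_of_nodup (List.nodup_finRange d)
    ((List.nodup_finRange d).map π.symm.injective)).2 fun i => by simpa using ⟨π i, by simp⟩
  length_eq := List.length_finRange
  bot_getElem? j := by simp
  colSum_eq j x hx := by
    simp only [List.getElem?_eq_getElem (show (j : ℕ) < (List.finRange d).length by simp),
      List.getElem_finRange, Option.some.injEq] at hx
    exact congrArg _ hx

lemma IsIrreducible.wordIrreducible {π : Equiv.Perm (Fin d)} (hi : IsIrreducible π) :
    WordIrreducible (List.finRange d) ((List.finRange d).map π.symm) := by
  intro k hk hkd hp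
  rw [List.length_finRange] at hkd
  obtain ⟨j, hj, hkj⟩ := isIrreducible_iff.1 hi k hk hkd
  have hmem : ∀ i : Fin d, i ∈ (List.finRange d).take k ↔ (i : ℕ) < k := fun i => by
    simp only [List.mem_take_iff_getElem, List.getElem_finRange, List.length_finRange]
    constructor
    · rintro ⟨l, hl, rfl⟩
      simp only [Fin.val_cast]
      omega
    · exact fun h => ⟨i, by omega, rfl⟩
  have := hp.mem_iff.1 ((hmem j).2 hj)
  rw [← List.map_take, List.mem_map] at this
  obtain ⟨i, hi, rfl⟩ := this
  rw [Equiv.apply_symm_apply] at hkj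
  have := (hmem i).1 hi
  omega

/-- A standard pair whose inner words end with the same letter represents a degenerate
permutation. -/
lemma Represents.isDegenerate {α : Type*} {A Z Q : α} {x y : List α} {h : α → ℤ}
    {π : Equiv.Perm (Fin d)} {N : Matrix (Fin d) (Fin d) ℤ}
    (hs : Represents (A :: (x ++ [Q, Z]), Z :: (y ++ [Q, A]), h) π N) : IsDegenerate π := by
  have hx : x.length + 3 = d := by simpa using hs.length_eq
  have hy : y.length + 3 = d := by simpa using hs.perm.length_eq.symm.trans hs.length_eq
  have h0 : π ⟨0, by omega⟩ = ⟨y.length + 2, by omega⟩ := hs.apply_eq (x := A) (by simp) (by simp)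
  have h1 : π ⟨x.length + 1, by omega⟩ = ⟨y.length + 1, by omega⟩ :=
    hs.apply_eq (x := Q) (by simp) (by simp)
  have h2 : π ⟨x.length + 2, by omega⟩ = ⟨0, by omega⟩ :=
    hs.apply_eq (x := Z) (by simp) (by simp)
  refine ⟨x.length + 1, by omega, Or.inr (Or.inr (Or.inl ⟨?_, ?_⟩))⟩
  · exact congrArg Fin.val h2
  · rw [h0, h1]

lemma Represents.mem {s : List (Fin d) × List (Fin d) × (Fin d → ℤ)} {π : Equiv.Perm (Fin d)}
    {N : Matrix (Fin d) (Fin d) ℤ} (hs : Represents s π N) (X : Fin d) : X ∈ s.1 := by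
  have : s.1.toFinset = Finset.univ := Finset.eq_univ_of_card _ (by
    rw [List.toFinset_card_of_nodup hs.nodup, hs.length_eq, Fintype.card_fin])
  exact List.mem_toFinset.1 (this ▸ Finset.mem_univ X)

variable [NeZero d]

/-- The permutation `σ` is a (4321) proxy with distinguished column `m`. -/
def IsProxy (hd : 4 ≤ d) (σ : Equiv.Perm (Fin d)) (m : Fin d) : Prop :=
  σ ⟨d - 4, by omega⟩ = lastIdx d ∧ σ ⟨d - 3, by omega⟩ = ⟨d - 2, by omega⟩ ∧
    σ ⟨d - 2, by omega⟩ = ⟨d - 3, by omega⟩ ∧ σ (lastIdx d) = ⟨0, by omega⟩ ∧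
    m = ⟨d - 4, by omega⟩

/-- The permutation `σ` is a (4321) quasi-proxy with distinguished column `m`. -/
def IsQuasiProxy (hd : 4 ≤ d) (σ : Equiv.Perm (Fin d)) (m : Fin d) : Prop :=
  σ ⟨0, by omega⟩ = lastIdx d ∧ σ ⟨d - 3, by omega⟩ = ⟨d - 2, by omega⟩ ∧
    σ ⟨d - 2, by omega⟩ = ⟨d - 3, by omega⟩ ∧ σ (lastIdx d) = ⟨0, by omega⟩ ∧
    m = ⟨0, by omega⟩

lemma Represents.isQuasiProxy (hd : 4 ≤ d) {α : Type*} {A Z Q R : α} {x y : List α} {h : α → ℤ}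
    {σ : Equiv.Perm (Fin d)} {N : Matrix (Fin d) (Fin d) ℤ}
    (hs : Represents (A :: (x ++ [Q, R, Z]), Z :: (y ++ [R, Q, A]), h) σ N) :
    IsQuasiProxy hd σ ⟨0, by omega⟩ ∧
      colSum N ⟨d - 3, by omega⟩ = h Q ∧ colSum N (lastIdx d) = h Z := by
  have hx : d = x.length + 4 := by simpa using hs.length_eq.symm
  have hy : y.length = x.length := by
    have : y.length + 4 = d := by simpa using hs.perm.length_eq.symm.trans hs.length_eq
    omega
  subst hx
  have hl : (lastIdx (x.length + 4) : ℕ) = x.length + 3 := rfl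
  refine ⟨⟨hs.apply_eq (x := A) ?_ ?_, hs.apply_eq (x := Q) ?_ ?_, hs.apply_eq (x := R) ?_ ?_,
    hs.apply_eq (x := Z) ?_ ?_, rfl⟩, hs.colSum_eq _ _ ?_, hs.colSum_eq _ _ ?_⟩ <;>
  simp [hl, ← hy]

lemma Represents.isProxy (hd : 4 ≤ d) {α : Type*} {P Q R Z : α} {x y : List α} {h : α → ℤ}
    {σ : Equiv.Perm (Fin d)} {N : Matrix (Fin d) (Fin d) ℤ}
    (hs : Represents (x ++ [P, Q, R, Z], Z :: (y ++ [R, Q, P]), h) σ N) :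
    IsProxy hd σ ⟨d - 4, by omega⟩ ∧
      colSum N ⟨d - 3, by omega⟩ = h Q ∧ colSum N (lastIdx d) = h Z := by
  have hx : d = x.length + 4 := by simpa using hs.length_eq.symm
  have hy : y.length = x.length := by
    have : y.length + 4 = d := by simpa using hs.perm.length_eq.symm.trans hs.length_eq
    omega
  subst hx
  have hl : (lastIdx (x.length + 4) : ℕ) = x.length + 3 := rfl
  refine ⟨⟨hs.apply_eq (x := P) ?_ ?_, hs.apply_eq (x := Q) ?_ ?_, hs.apply_eq (x := R) ?_ ?_,
    hs.apply_eq (x := Z) ?_ ?_, rfl⟩, hs.colSum_eq _ _ ?_, hs.colSum_eq _ _ ?_⟩ <;>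
  simp [hl, ← hy]

/-- Every standard pair with distinct last inner letters leads to a proxy or a quasi-proxy with
coprime column sums. -/
lemma exists_proxy_of_standard (hd : 4 ≤ d) {A Z : Fin d} {x y : List (Fin d)} {h : Fin d → ℤ}
    {π : Equiv.Perm (Fin d)} {N : Matrix (Fin d) (Fin d) ℤ}
    (hs : Represents (A :: (x ++ [Z]), Z :: (y ++ [A]), h) π N) (hnd : ¬ IsDegenerate π)
    (hpos : ∀ x, 0 < h x) (hprim : Primitive h) :
    ∃ r σ N' m, 0 < r ∧ RauzyPath π N r σ N' ∧ (IsProxy hd σ m ∨ IsQuasiProxy hd σ m) ∧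
      IsCoprime (colSum N' ⟨d - 3, by omega⟩) (colSum N' (lastIdx d)) := by
  have hx : x.length + 2 = d := by simpa using hs.length_eq
  have hy : y.length + 2 = d := by simpa using hs.perm.length_eq.symm.trans hs.length_eq
  obtain ⟨x, R, rfl⟩ := (List.eq_nil_or_concat' x).resolve_left (by rintro rfl; simp at hx; omega)
  obtain ⟨y, Q, rfl⟩ := (List.eq_nil_or_concat' y).resolve_left (by rintro rfl; simp at hy; omega)
  simp only [List.append_assoc, List.cons_append, List.nil_append] at hs
  have hQR : Q ≠ R := by
    rintro rfl
    exact hnd hs.isDegenerate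
  have ht := hs.nodup
  have hp := hs.perm
  have hb := hp.nodup_iff.1 ht
  have hQ : Q ∈ x := by
    have := hp.mem_iff.2 (show Q ∈ Z :: (y ++ [Q, A]) by simp)
    simp [List.nodup_append] at this hb
    grind
  have hR : R ∈ y := by
    have := hp.mem_iff.1 (show R ∈ A :: (x ++ [R, Z]) by simp)
    simp [List.nodup_append] at this ht
    grind
  obtain ⟨x₁, x₂, rfl⟩ := List.append_of_mem hQ
  obtain ⟨y₁, y₂, rfl⟩ := List.append_of_mem hR
  simp only [List.append_assoc, List.cons_append] at hs ht hp
  -- the loop producing coprime weights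
  have loop : ∀ (Q' : Fin d) (x' y' : List (Fin d)), Q' ∈ x' →
      Conn (A :: (x₁ ++ Q :: (x₂ ++ [R, Z]))) (Z :: (y₁ ++ R :: (y₂ ++ [Q, A])))
        (A :: (x' ++ [Z])) (Z :: (y' ++ [A])) →
      ∃ r σ N' h', 0 < r ∧ RauzyPath π N r σ N' ∧
        Represents (A :: (x' ++ [Z]), Z :: (y' ++ [A]), h') σ N' ∧
        IsCoprime (h' Q') (h' Z) := fun Q' x' y' hQ' hc => by
    obtain ⟨h₁, p⟩ := hc h
    obtain ⟨m₁, π₁, N₁, p₁, s₁⟩ := WordPath.exists_rauzyPath p hs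
    obtain ⟨h₂, q, hcop⟩ := exists_coprime_weights A Z Q' x' y' h₁ s₁.nodup s₁.perm
      s₁.mem (WordPath.pos p hpos)
      (WordPath.primitive p ht (hp.nodup_iff.1 ht) hprim) hQ'
    obtain ⟨m₂, π₂, N₂, hm, p₂, s₂⟩ := exists_rauzyPath_of_transGen q s₁
    exact ⟨m₁ + m₂, π₂, N₂, h₂, by omega, p₁.trans p₂, s₂, hcop⟩
  rcases exists_reversed_tail A Z Q R x₁ x₂ y₁ y₂ ht hp with
    ⟨Q', R', x', y', hc⟩ | ⟨P', Q', R', x', y', z, hc⟩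
  · obtain ⟨r, σ, N', h', hr, p, s, hcop⟩ := loop Q' (x' ++ [Q', R']) (y' ++ [R', Q']) (by simp)
      (by simpa using hc)
    simp only [List.append_assoc, List.cons_append, List.nil_append] at s
    obtain ⟨hσ, e₁, e₂⟩ := s.isQuasiProxy hd
    exact ⟨r, σ, N', _, hr, p, .inr hσ, by rwa [e₁, e₂]⟩
  · obtain ⟨r, σ, N', h', hr, p, s, hcop⟩ := loop Q' (x' ++ [P', Q', R'])
      (y' ++ R' :: Q' :: P' :: z) (by simp) (by simpa using hc)
    have hn := s.perm.nodup_iff.1 s.nodup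
    have hn' : (Z :: (z ++ [A])).Nodup ∧ Q' ∉ z ++ [A] := by
      simp [List.nodup_append] at hn ⊢
      grind
    obtain ⟨r', σ', N'', p', s'⟩ := WordPath.exists_rauzyPath
      (wordPath_rotate_bot (A :: (x' ++ [P', Q', R'])) Z [] (y' ++ [R', Q', P']) (z ++ [A]) h'
        hn'.1) (by simpa using s)
    have s'' : Represents ((A :: x') ++ [P', Q', R', Z],
        Z :: ((z ++ A :: y') ++ [R', Q', P']),
        fun x => if x ∈ z ++ [A] then h' x + h' Z else h' x) σ' N'' := by simpa using s'
    obtain ⟨hσ, e₁, e₂⟩ := s''.isProxy hd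
    refine ⟨r + r', σ', N'', _, by omega, p.trans p', .inl hσ, ?_⟩
    rw [e₁, e₂]
    simpa [hn'.2, (List.nodup_cons.1 hn'.1).1] using hcop

lemma exists_proxy_path (hd : 4 ≤ d) {π₀ π : Equiv.Perm (Fin d)}
    {N : Matrix (Fin d) (Fin d) ℤ} {n : ℕ} (hp : RauzyPath π₀ 1 n π N) (hi : IsIrreducible π)
    (hnd : ¬ IsDegenerate π) :
    ∃ r σ N' m, 0 < r ∧ RauzyPath π N r σ N' ∧ (IsProxy hd σ m ∨ IsQuasiProxy hd σ m) ∧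
      IsCoprime (colSum N' ⟨d - 3, by omega⟩) (colSum N' (lastIdx d)) := by
  have hs := represents_finRange π N
  have hw := hi.wordIrreducible
  have hlen := hs.length_eq
  obtain ⟨t, Z, ht⟩ := (List.eq_nil_or_concat' (List.finRange d)).resolve_left fun h => by
    simp [h] at hlen; omega
  obtain ⟨b₁, b₂, hb⟩ := List.append_of_mem
    (hs.perm.mem_iff.1 (show Z ∈ List.finRange d by simp))
  simp only at hb
  rw [hb, ht] at hs hw
  have hnil : t ≠ [] := by
    rintro rfl
    simp [ht] at hlen
    omega
  obtain ⟨A, Z', x, y, hc⟩ := exists_standard t Z b₁ b₂ hs.nodup hs.perm hnil hw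
  obtain ⟨h, p⟩ := hc (colSum N)
  obtain ⟨m, π₁, N₁, p₁, s₁⟩ := WordPath.exists_rauzyPath p hs
  obtain ⟨r, σ, N', k, hr, q, hσ, hcop⟩ := exists_proxy_of_standard hd s₁
    (p₁.not_isDegenerate hnd) (WordPath.pos p hp.colSum_pos)
    (WordPath.primitive p hs.nodup (hs.perm.nodup_iff.1 hs.nodup) hp.primitive_colSum)
  exact ⟨m + r, σ, N', k, by omega, p₁.trans q, hσ, hcop⟩

end Proxies

section Simplex

variable {d : ℕ}

/-- The vectors of the open cone of `M` whose entries sum to one. -/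
def coneSlice (M : Matrix (Fin d) (Fin d) ℤ) : Set (Fin d → ℝ) :=
  {L | (∃ v : Fin d → ℝ, (∀ i, 0 < v i) ∧ L = (M.map (Int.cast : ℤ → ℝ)).mulVec v) ∧
    ∑ i, L i = 1}

lemma isOpen_coneSlice {M : Matrix (Fin d) (Fin d) ℤ}
    (hM : Function.Injective (M.map (Int.cast : ℤ → ℝ)).mulVec) :
    IsOpen (Subtype.val ⁻¹' coneSlice M : Set (stdSimplex ℝ (Fin d))) := by
  have hdet := (Matrix.isUnit_iff_isUnit_det _).1 (Matrix.mulVec_injective_iff_isUnit.1 hM)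
  have heq : (Subtype.val ⁻¹' coneSlice M : Set (stdSimplex ℝ (Fin d))) =
      {L | ∀ i, 0 < ((M.map (Int.cast : ℤ → ℝ))⁻¹).mulVec L.1 i} := by
    ext L
    constructor
    · rintro ⟨⟨v, hv, hL⟩, -⟩ i
      rw [hL, Matrix.mulVec_mulVec, Matrix.nonsing_inv_mul _ hdet, Matrix.one_mulVec]
      exact hv i
    · exact fun h => ⟨⟨_, h, by
        rw [Matrix.mulVec_mulVec, Matrix.mul_nonsing_inv _ hdet, Matrix.one_mulVec]⟩, L.2.2⟩
  rw [heq, Set.ofPred_forall]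
  exact isOpen_iInter_of_finite fun i => isOpen_lt continuous_const
    ((continuous_apply i).comp (Continuous.matrix_mulVec continuous_const continuous_subtype_val))

variable [NeZero d]

lemma RauzyPath.nonempty_coneSlice {π₀ π : Equiv.Perm (Fin d)} {N : Matrix (Fin d) (Fin d) ℤ}
    {m : ℕ} (h : RauzyPath π₀ 1 m π N) : (coneSlice N).Nonempty := by
  set w := (N.map (Int.cast : ℤ → ℝ)).mulVec fun _ => 1 with hw
  have hs : 0 < ∑ i, w i :=
    Finset.sum_pos (fun i _ => h.mulVec_pos _ (fun _ => one_pos) i) Finset.univ_nonempty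
  refine ⟨(∑ i, w i)⁻¹ • w, ⟨(∑ i, w i)⁻¹ • fun _ => 1, fun i => by simpa using hs,
    (Matrix.mulVec_smul _ _ _).symm⟩, ?_⟩
  simp only [Pi.smul_apply, smul_eq_mul, ← Finset.mul_sum]
  exact inv_mul_cancel₀ hs.ne'

lemma RauzyPath.coneSlice_subset {π₀ π₁ π : Equiv.Perm (Fin d)}
    {N Γ : Matrix (Fin d) (Fin d) ℤ} {m k : ℕ} (h : RauzyPath π₀ 1 m π (N * Γ))
    (hΓ : RauzyPath π₁ 1 k π Γ) : coneSlice (N * Γ) ⊆ matSimplex N := by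
  rintro _ ⟨⟨v, hv, rfl⟩, hsum⟩
  exact ⟨⟨_, fun i => (hΓ.mulVec_pos v hv i).le, map_mul_mulVec N Γ v⟩, h.mulVec_pos v hv, hsum⟩

end Simplex


/-- Let `d > 3` and let `T` be an IET with irreducible non-degenerate
permutation `π`, admitting `n` steps of Rauzy induction.  Then there are a (4321)
proxy or quasi-proxy `σ` in the Rauzy class of `π` (with distinguished column index
`mIdx = d-3` resp. `1`, written 0-indexed), `r > 0` and a nonempty relatively open
`U ⊆ M(T,n)_Δ` such that every IET `S` with `π(S) = π` and lengths in `U` admits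
`n + r` steps, ends at `σ`, and the matrix `N = M(S,n+r)` satisfies
`gcd(|C_mIdx(N)|, |C_{d-2}(N)|, |C_{d-1}(N)|, |C_d(N)|) = 1`. -/
theorem proxy_gcd_columns {d : ℕ} [NeZero d] (hd : 3 < d) (n : ℕ) (T : IET d)
    (hirr : IsIrreducible T.perm) (hnd : ¬ IsDegenerate T.perm)
    (hpos : ∀ i, 0 < T.len i) (c : RauzyChain d n) (hc0 : c.seq 0 = T) :
    ∃ σ : Equiv.Perm (Fin d), InRauzyClass T.perm σ ∧
    ∃ mIdx : Fin d,
      ((σ ⟨d - 4, by omega⟩ = lastIdx d ∧ σ ⟨d - 3, by omega⟩ = ⟨d - 2, by omega⟩ ∧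
          σ ⟨d - 2, by omega⟩ = ⟨d - 3, by omega⟩ ∧ σ (lastIdx d) = ⟨0, by omega⟩ ∧
          mIdx = ⟨d - 4, by omega⟩) ∨
        (σ ⟨0, by omega⟩ = lastIdx d ∧ σ ⟨d - 3, by omega⟩ = ⟨d - 2, by omega⟩ ∧
          σ ⟨d - 2, by omega⟩ = ⟨d - 3, by omega⟩ ∧ σ (lastIdx d) = ⟨0, by omega⟩ ∧
          mIdx = ⟨0, by omega⟩)) ∧
      ∃ r : ℕ, 0 < r ∧ ∃ U : Set (Fin d → ℝ), U ⊆ matSimplex (chainMatrix c n) ∧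
        U.Nonempty ∧ IsOpen ((Subtype.val ⁻¹' U) : Set (stdSimplex ℝ (Fin d))) ∧
        ∀ S : IET d, S.perm = T.perm → S.len ∈ U →
          ∃ c' : RauzyChain d (n + r), c'.seq 0 = S ∧ (c'.seq (n + r)).perm = σ ∧
            Int.gcd
              ((Int.gcd
                ((Int.gcd (colSum (chainMatrix c' (n + r)) mIdx)
                  (colSum (chainMatrix c' (n + r)) ⟨d - 3, by omega⟩) : ℕ) : ℤ)
                (colSum (chainMatrix c' (n + r)) ⟨d - 2, by omega⟩) : ℕ) : ℤ)
              (colSum (chainMatrix c' (n + r)) (lastIdx d)) = 1 := by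
  have hp := c.rauzyPath le_rfl
  rw [hc0] at hp
  obtain ⟨r, σ, N', m, hr, p, hσ, hcop⟩ :=
    exists_proxy_path hd hp (hp.isIrreducible hirr) (hp.not_isDegenerate hnd)
  have full := hp.trans p
  obtain ⟨Γ, hΓ, rfl⟩ := p.exists_factor
  refine ⟨σ, full.inRauzyClass, m, hσ, r, hr, coneSlice (chainMatrix c n * Γ),
    full.coneSlice_subset hΓ, full.nonempty_coneSlice, isOpen_coneSlice full.mulVec_injective, ?_⟩
  rintro ⟨π, L⟩ rfl ⟨⟨v, hv, hL⟩, -⟩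
  obtain ⟨c', h0, hl, hM⟩ := full.exists_chain v hv
  refine ⟨c', h0.trans (congrArg _ hL.symm), congrArg IET.perm hl, ?_⟩
  rw [hM, ← Nat.isUnit_iff, ← Int.ofNat_isUnit]
  refine hcop.isUnit_of_dvd' ?_ (Int.gcd_dvd_right _ _)
  exact (Int.gcd_dvd_left _ _).trans ((Int.gcd_dvd_left _ _).trans (Int.gcd_dvd_right _ _))

end IETPaper
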